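/- arXiv:1304.0295 — 3 statements merged into one kernel-verified Lean document; each statement's English description precedes it below -/
import Mathlib

section
/- For every n ≥ 2 and a ∈ ℂ with a ≠ 0, the KMS matrix J_n(a) is irreducible (it is not unitarily similar to a direct sum of two square matrices of smaller sizes), and 0 lies in the topological interior of W(J_n(a)). -/
open Matrix

noncomputable def KMS (n : ℕ) (a : ℂ) : Matrix (Fin n) (Fin n) ℂ :=
  Matrix.of fun j k => if (j : ℕ) < (k : ℕ) then a ^ ((k : ℕ) - (j : ℕ)) else 0

noncomputable def numRange {m : Type*} [Fintype m] (A : Matrix m m ℂ) : Set ℂ :=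
  {z | ∃ x : m → ℂ, star x ⬝ᵥ x = 1 ∧ star x ⬝ᵥ (A *ᵥ x) = z}

/-- The nilpotent upper shift matrix. -/
def upperShift (n : ℕ) : Matrix (Fin n) (Fin n) ℂ :=
  Matrix.of fun j k => if (j : ℕ) + 1 = (k : ℕ) then 1 else 0

theorem mul_upperShift_apply_zero {m : ℕ} (M : Matrix (Fin (m + 1)) (Fin (m + 1)) ℂ)
    (i : Fin (m + 1)) : (M * upperShift (m + 1)) i 0 = 0 := by
  simp [Matrix.mul_apply, upperShift]

theorem mul_upperShift_apply_succ {m : ℕ} (M : Matrix (Fin (m + 1)) (Fin (m + 1)) ℂ)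
    (i : Fin (m + 1)) (j : Fin m) :
    (M * upperShift (m + 1)) i j.succ = M i j.castSucc := by
  rw [Matrix.mul_apply, Finset.sum_eq_single j.castSucc]
  · simp [upperShift]
  · intro b _ hb
    have : (b : ℕ) ≠ j := fun h => hb (Fin.ext h)
    simp [upperShift, this]
  · simp

theorem upperShift_mul_apply_castSucc {m : ℕ} (M : Matrix (Fin (m + 1)) (Fin (m + 1)) ℂ)
    (i : Fin m) (j : Fin (m + 1)) :
    (upperShift (m + 1) * M) i.castSucc j = M i.succ j := by
  rw [Matrix.mul_apply, Finset.sum_eq_single i.succ]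
  · simp [upperShift]
  · intro b _ hb
    have : (i : ℕ) + 1 ≠ b := fun h => hb (Fin.ext h.symm)
    simp [upperShift, this]
  · simp

theorem KMS_eq_add_mul_upperShift (m : ℕ) (a : ℂ) :
    KMS (m + 1) a = a • upperShift (m + 1) + a • (KMS (m + 1) a * upperShift (m + 1)) := by
  ext j k
  simp only [Matrix.add_apply, Matrix.smul_apply]
  refine Fin.cases ?_ (fun k => ?_) k
  · rw [mul_upperShift_apply_zero]
    simp [KMS, upperShift]
  · rw [mul_upperShift_apply_succ]
    simp only [KMS, upperShift, Matrix.of_apply, Fin.val_succ, Fin.val_castSucc, smul_eq_mul]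
    rcases lt_trichotomy (j : ℕ) (k : ℕ) with h | h | h
    · have h1 : (k : ℕ) + 1 - j = (k - j) + 1 := by omega
      rw [if_pos (by omega), if_neg (by omega), if_pos h, h1, pow_succ]
      ring
    · simp [h]
    · rw [if_neg (by omega), if_neg (by omega), if_neg (by omega)]
      simp

/-- A Hermitian matrix commuting with the upper shift is scalar. -/
theorem eq_scalar_of_commute_upperShift {m : ℕ} {P : Matrix (Fin (m + 1)) (Fin (m + 1)) ℂ}
    (hP : P.IsHermitian) (hc : P * upperShift (m + 1) = upperShift (m + 1) * P) :
    P = (P 0 0) • (1 : Matrix (Fin (m + 1)) (Fin (m + 1)) ℂ) := by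
  have hcol : ∀ i : Fin m, P i.succ 0 = 0 := fun i => by
    rw [← upperShift_mul_apply_castSucc P, ← hc, mul_upperShift_apply_zero]
  have hrow : ∀ i : Fin m, P 0 i.succ = 0 := fun i => by
    rw [← hP.apply, hcol, star_zero]
  have hdiag : ∀ i j : Fin m, P i.succ j.succ = P i.castSucc j.castSucc := fun i j => by
    rw [← upperShift_mul_apply_castSucc P, ← hc, mul_upperShift_apply_succ]
  ext i j
  induction i using Fin.induction generalizing j with
  | zero =>
    refine Fin.cases ?_ (fun j => ?_) j
    · simp
    · rw [hrow]
      simp [(Fin.succ_ne_zero j).symm]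
  | succ i ih =>
    refine Fin.cases ?_ (fun j => ?_) j
    · rw [hcol]
      simp [Fin.succ_ne_zero i]
    · rw [hdiag, ih]
      simp [Matrix.one_apply]

/-- A Hermitian matrix commuting with a nonzero KMS matrix is scalar. -/
theorem eq_scalar_of_commute_KMS {m : ℕ} {a : ℂ} (ha : a ≠ 0)
    {P : Matrix (Fin (m + 1)) (Fin (m + 1)) ℂ}
    (hP : P.IsHermitian) (hc : P * KMS (m + 1) a = KMS (m + 1) a * P) :
    P = (P 0 0) • (1 : Matrix (Fin (m + 1)) (Fin (m + 1)) ℂ) := by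
  refine eq_scalar_of_commute_upperShift hP ?_
  have hinv : (1 + KMS (m + 1) a) * (1 - a • upperShift (m + 1)) = 1 := by
    have h := KMS_eq_add_mul_upperShift m a
    rw [mul_sub, mul_one, add_mul, one_mul, Matrix.mul_smul]
    nth_rewrite 1 [h]
    abel
  have hinv' := mul_eq_one_comm.mp hinv
  have hc1 : Commute P (1 + KMS (m + 1) a) := (Commute.one_right P).add_right hc
  have hc2 : P * (1 - a • upperShift (m + 1)) = (1 - a • upperShift (m + 1)) * P := by
    calc P * (1 - a • upperShift (m + 1))
        = (1 - a • upperShift (m + 1)) * (1 + KMS (m + 1) a) * P *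
            (1 - a • upperShift (m + 1)) := by rw [hinv', one_mul]
      _ = (1 - a • upperShift (m + 1)) * P *
            ((1 + KMS (m + 1) a) * (1 - a • upperShift (m + 1))) := by
          rw [mul_assoc _ (1 + KMS (m + 1) a) P, ← hc1.eq]
          simp only [mul_assoc]
      _ = (1 - a • upperShift (m + 1)) * P := by rw [hinv, mul_one]
  rw [mul_sub, sub_mul, mul_one, one_mul, Matrix.mul_smul, Matrix.smul_mul] at hc2
  exact smul_right_injective _ ha (sub_right_injective hc2)

/-- The numerical range of a KMS matrix contains the disc of radius `‖a‖ / 2`. -/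
theorem ball_subset_numRange_KMS (m : ℕ) {a : ℂ} (ha : a ≠ 0) :
    Metric.ball (0 : ℂ) (‖a‖ / 2) ⊆ numRange (KMS (m + 2) a) := by
  intro z hz
  rw [mem_ball_zero_iff] at hz
  have ha' : 0 < ‖a‖ := norm_pos_iff.mpr ha
  obtain ⟨w, rfl⟩ : ∃ w, z = a * w := ⟨z / a, by field_simp⟩
  have hw : ‖w‖ < 1 / 2 := by
    rw [norm_mul] at hz
    nlinarith
  have hd : 0 ≤ 1 - 4 * ‖w‖ ^ 2 := by nlinarith [norm_nonneg w]
  obtain ⟨t, ht, hteq⟩ : ∃ t : ℝ, 0 < t ∧ t * t + ‖w‖ ^ 2 = t :=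
    ⟨(1 + √(1 - 4 * ‖w‖ ^ 2)) / 2, by positivity, by nlinarith [Real.mul_self_sqrt hd]⟩
  have hs : ((√t : ℝ) : ℂ) * (√t : ℝ) = t := by
    rw [← Complex.ofReal_mul, Real.mul_self_sqrt ht.le]
  have hs0 : ((√t : ℝ) : ℂ) ≠ 0 := Complex.ofReal_ne_zero.mpr (Real.sqrt_pos.mpr ht).ne'
  have htC : (t : ℂ) * t + w * (starRingEnd ℂ) w = t := by
    rw [Complex.mul_conj']
    exact_mod_cast hteq
  refine ⟨Fin.cons ((√t : ℝ) : ℂ) (Fin.cons (w / (√t : ℝ)) 0), ?_, ?_⟩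
  · simp only [dotProduct, Fin.sum_univ_succ, Pi.star_apply, Fin.cons_zero, Fin.cons_succ,
      Pi.zero_apply, mul_zero, Finset.sum_const_zero, add_zero, RCLike.star_def, map_div₀,
      Complex.conj_ofReal]
    have ht0 : (t : ℂ) ≠ 0 := Complex.ofReal_ne_zero.mpr ht.ne'
    rw [div_mul_div_comm, hs]
    field_simp
    linear_combination htC
  · simp only [dotProduct, Matrix.mulVec, Fin.sum_univ_succ, Pi.star_apply, Fin.cons_zero,
      Fin.cons_succ, Pi.zero_apply, mul_zero, Finset.sum_const_zero, add_zero, RCLike.star_def,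
      Complex.conj_ofReal, map_zero, zero_mul, KMS, Matrix.of_apply]
    simp
    field_simp

/-- For `n ≥ 2` and `a ≠ 0`, the KMS matrix `J_n(a)` is irreducible (not unitarily similar
to a direct sum of two square matrices of smaller sizes), and `0` lies in the interior of
its numerical range. -/
theorem stmt_2 (n : ℕ) (hn : 2 ≤ n) (a : ℂ) (ha : a ≠ 0) :
    (¬ ∃ (k l : ℕ) (_ : 0 < k) (_ : 0 < l) (h : k + l = n)
        (U : Matrix (Fin n) (Fin n) ℂ) (_ : U ∈ Matrix.unitaryGroup (Fin n) ℂ)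
        (B : Matrix (Fin k) (Fin k) ℂ) (C : Matrix (Fin l) (Fin l) ℂ),
        Uᴴ * KMS n a * U =
          Matrix.reindex (finSumFinEquiv.trans (finCongr h)) (finSumFinEquiv.trans (finCongr h))
            (Matrix.fromBlocks B 0 0 C)) ∧
    (0 : ℂ) ∈ interior (numRange (KMS n a)) := by
  obtain ⟨m, rfl⟩ : ∃ m, n = m + 2 := ⟨n - 2, by omega⟩
  constructor
  · rintro ⟨k, l, hk, hl, h, U, hU, B, C, hD⟩
    set e := finSumFinEquiv.trans (finCongr h)
    set D := Matrix.reindex e e (Matrix.fromBlocks B 0 0 C)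
    set Q : Matrix (Fin (m + 2)) (Fin (m + 2)) ℂ :=
      Matrix.reindex e e (Matrix.fromBlocks 1 0 0 0) with hQ
    have hUU : U * Uᴴ = 1 := Matrix.mem_unitaryGroup_iff.mp hU
    have hUU' : Uᴴ * U = 1 := Matrix.mem_unitaryGroup_iff'.mp hU
    have hQD : Q * D = D * Q := by
      simp [Q, D, Matrix.fromBlocks_multiply, Matrix.submatrix_mul_equiv]
    have hQH : Q.IsHermitian := by
      simp [Q, Matrix.IsHermitian, Matrix.conjTranspose_submatrix,
        Matrix.fromBlocks_conjTranspose]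
    have hUA : Uᴴ * KMS (m + 2) a = D * Uᴴ := by
      rw [← hD, mul_assoc _ U, hUU, mul_one]
    have hAU : KMS (m + 2) a * U = U * D := by
      rw [← hD, mul_assoc, ← mul_assoc, hUU, one_mul]
    have hc : U * Q * Uᴴ * KMS (m + 2) a = KMS (m + 2) a * (U * Q * Uᴴ) := by
      calc U * Q * Uᴴ * KMS (m + 2) a = U * (Q * D) * Uᴴ := by
            rw [mul_assoc, hUA]; simp only [mul_assoc]
        _ = KMS (m + 2) a * (U * Q * Uᴴ) := by
            rw [hQD, ← mul_assoc, ← hAU]; simp only [mul_assoc]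
    have hscalar := eq_scalar_of_commute_KMS ha
      (Matrix.isHermitian_mul_mul_conjTranspose U hQH) hc
    generalize (U * Q * Uᴴ) 0 0 = c at hscalar
    have hQc : Q = c • (1 : Matrix (Fin (m + 2)) (Fin (m + 2)) ℂ) := by
      calc Q = Uᴴ * U * Q * (Uᴴ * U) := by rw [hUU', one_mul, mul_one]
        _ = Uᴴ * (U * Q * Uᴴ) * U := by simp only [mul_assoc]
        _ = c • (1 : Matrix (Fin (m + 2)) (Fin (m + 2)) ℂ) := by
          rw [hscalar, Matrix.mul_smul, mul_one, Matrix.smul_mul, hUU']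
    have h1 := congrFun₂ hQc (e (Sum.inl ⟨0, hk⟩)) (e (Sum.inl ⟨0, hk⟩))
    have h0 := congrFun₂ hQc (e (Sum.inr ⟨0, hl⟩)) (e (Sum.inr ⟨0, hl⟩))
    simp only [hQ, Matrix.reindex_apply, Matrix.submatrix_apply, Equiv.symm_apply_apply,
      Matrix.fromBlocks_apply₁₁, Matrix.fromBlocks_apply₂₂, Matrix.one_apply_eq,
      Matrix.smul_apply, Matrix.zero_apply, smul_eq_mul, mul_one] at h1 h0
    exact one_ne_zero (h1.trans h0.symm)
  · exact mem_interior.mpr ⟨_, ball_subset_numRange_KMS m ha, Metric.isOpen_ball,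
      Metric.mem_ball_self (by positivity)⟩
end

section
/- If 1 ≤ m < n, a ∈ ℂ with a ≠ 0, and A is an m×m compression of J_n(a), then W(A) is a proper subset of W(J_n(a)): W(A) ⊆ W(J_n(a)) and W(A) ≠ W(J_n(a)). -/
open Matrix

open Polynomial

lemma chebyshev_U_eval_add_two (k : ℕ) (x : ℂ) :
    (Chebyshev.U ℂ ((k + 2 : ℕ) : ℤ)).eval x =
      2 * x * (Chebyshev.U ℂ ((k + 1 : ℕ) : ℤ)).eval x - (Chebyshev.U ℂ (k : ℤ)).eval x := by
  push_cast
  rw [Chebyshev.U_add_two]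
  simp

lemma chebyshev_U_eval_mul_sub {ζ ζ' x : ℂ} (h : ζ * ζ' = 1) (hx : ζ + ζ' = 2 * x) (k : ℕ) :
    (Chebyshev.U ℂ (k : ℤ)).eval x * (ζ - ζ') = ζ ^ (k + 1) - ζ' ^ (k + 1) := by
  induction k using Nat.twoStepInduction with
  | zero => simp
  | one => simp; linear_combination (ζ' - ζ) * hx
  | more k h0 h1 =>
    rw [chebyshev_U_eval_add_two, sub_mul, mul_assoc, h1, h0, ← hx]
    linear_combination (ζ ^ (k + 1) - ζ' ^ (k + 1)) * h

lemma chebyshev_U_eval_pell (k : ℕ) (x : ℂ) :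
    (Chebyshev.U ℂ ((k + 1 : ℕ) : ℤ)).eval x ^ 2
      - 2 * x * (Chebyshev.U ℂ ((k + 1 : ℕ) : ℤ)).eval x * (Chebyshev.U ℂ (k : ℤ)).eval x
      + (Chebyshev.U ℂ (k : ℤ)).eval x ^ 2 = 1 := by
  induction k with
  | zero => simp; ring
  | succ k ih =>
    rw [chebyshev_U_eval_add_two]
    linear_combination ih

lemma chebyshev_U_eval_succ_ne_zero {k : ℕ} {x : ℂ}
    (h : (Chebyshev.U ℂ (k : ℤ)).eval x = 0) :
    (Chebyshev.U ℂ ((k + 1 : ℕ) : ℤ)).eval x ≠ 0 := by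
  intro h'
  have := chebyshev_U_eval_pell k x
  rw [h, h'] at this
  simp at this

/-- The point `cos (π / (n + 1))` is a root of `U n` but of no earlier `U i`. -/
lemma exists_chebyshev_U_root (n : ℕ) (hn : 1 ≤ n) :
    ∃ z : ℂ, (Chebyshev.U ℂ (n : ℤ)).eval z = 0 ∧
      ∀ i < n, (Chebyshev.U ℂ (i : ℤ)).eval z ≠ 0 := by
  have hpos : (0 : ℝ) < n + 1 := by positivity
  have hsin : Real.sin (Real.pi / (n + 1)) ≠ 0 := by
    refine (Real.sin_pos_of_pos_of_lt_pi (by positivity) ?_).ne'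
    rw [div_lt_iff₀ hpos]
    have : (1 : ℝ) ≤ n := by exact_mod_cast hn
    nlinarith [Real.pi_pos]
  refine ⟨(Real.cos (Real.pi / (n + 1)) : ℝ), ?_, fun i hi h => ?_⟩
  · rw [← Chebyshev.complex_ofReal_eval_U, Complex.ofReal_eq_zero]
    have := Chebyshev.U_real_cos (Real.pi / (n + 1)) n
    rw [Int.cast_natCast, mul_div_cancel₀ _ hpos.ne', Real.sin_pi] at this
    exact (mul_eq_zero.1 this).resolve_right hsin
  · rw [← Chebyshev.complex_ofReal_eval_U, Complex.ofReal_eq_zero] at h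
    have := Chebyshev.U_real_cos (Real.pi / (n + 1)) i
    rw [h, zero_mul, Int.cast_natCast] at this
    refine (Real.sin_pos_of_pos_of_lt_pi (by positivity) ?_).ne this
    rw [← mul_div_assoc, div_lt_iff₀ hpos, mul_comm]
    have : (i : ℝ) < n := by exact_mod_cast hi
    gcongr

/-- The homogenisation of the Chebyshev polynomials of the second kind: when `M = 2 x B`,
`homogU M B k` equals `B ^ k * U k (x)`. -/
noncomputable def homogU (M B : ℂ[X]) : ℕ → ℂ[X]
  | 0 => 1
  | 1 => M
  | k + 2 => M * homogU M B (k + 1) - B ^ 2 * homogU M B k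

lemma eval_homogU {M B : ℂ[X]} {t x : ℂ} (h : M.eval t = 2 * x * B.eval t) (k : ℕ) :
    (homogU M B k).eval t = B.eval t ^ k * (Chebyshev.U ℂ (k : ℤ)).eval x := by
  induction k using Nat.twoStepInduction with
  | zero => simp [homogU]
  | one => simp [homogU, h]; ring
  | more k h0 h1 =>
    rw [chebyshev_U_eval_add_two, homogU]
    simp only [eval_sub, eval_mul, eval_pow, h0, h1, h]
    ring

lemma eval_homogU_of_eq_zero {M B : ℂ[X]} {t : ℂ} (h : B.eval t = 0) (k : ℕ) :
    (homogU M B k).eval t = M.eval t ^ k := by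
  induction k using Nat.twoStepInduction with
  | zero => simp [homogU]
  | one => simp [homogU]
  | more k h0 h1 =>
    rw [homogU]
    simp only [eval_sub, eval_mul, eval_pow, h0, h1, h]
    ring

lemma sum_chebyshev_U_mul_eq_zero {p : ℕ} {ν u : ℕ → ℂ} {ζ ζ' x : ℂ}
    (h : ζ * ζ' = 1) (hne : ζ ≠ ζ') (hx : ζ + ζ' = 2 * x)
    (h1 : ∑ i ∈ Finset.range (p + 2), ν i * ζ ^ i * u i = 0)
    (h2 : ∑ i ∈ Finset.range (p + 2), ν i * ζ' ^ i * u i = 0) :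
    ∑ i ∈ Finset.range (p + 1), ν i * (Chebyshev.U ℂ ((p - i : ℕ) : ℤ)).eval x * u i = 0 := by
  have key : ∑ i ∈ Finset.range (p + 2),
      ν i * (ζ ^ (p + 1 - i) - ζ' ^ (p + 1 - i)) * u i = 0 := by
    have e : ∀ i ∈ Finset.range (p + 2), ν i * (ζ ^ (p + 1 - i) - ζ' ^ (p + 1 - i)) * u i =
        ζ ^ (p + 1) * (ν i * ζ' ^ i * u i) - ζ' ^ (p + 1) * (ν i * ζ ^ i * u i) := by
      intro i hi
      obtain ⟨j, hj⟩ := Nat.exists_eq_add_of_le (Nat.lt_succ_iff.1 (Finset.mem_range.1 hi))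
      have hi1 : ζ ^ i * ζ' ^ i = 1 := by rw [← mul_pow, h, one_pow]
      rw [hj, Nat.add_sub_cancel_left, pow_add, pow_add]
      linear_combination (-(ν i * u i * (ζ ^ j - ζ' ^ j))) * hi1
    rw [Finset.sum_congr rfl e, Finset.sum_sub_distrib, ← Finset.mul_sum, ← Finset.mul_sum,
      h1, h2]
    simp
  rw [Finset.sum_range_succ] at key
  simp only [Nat.sub_self, pow_zero, sub_self, mul_zero, zero_mul, add_zero] at key
  refine (mul_eq_zero.1 (?_ : _ * (ζ - ζ') = 0)).resolve_right (sub_ne_zero.2 hne)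
  rw [← key, Finset.sum_mul]
  refine Finset.sum_congr rfl fun i hi => ?_
  have : p + 1 - i = p - i + 1 := by have := Finset.mem_range.1 hi; omega
  rw [this, ← chebyshev_U_eval_mul_sub h hx]
  ring

lemma sum_chebyshev_U_sq_eq_zero {p : ℕ} {ν u : ℕ → ℂ} {ζ ζ' x : ℂ}
    (h : ζ * ζ' = 1) (hne : ζ ≠ ζ') (hx : ζ + ζ' = 2 * x)
    (h1 : ∑ i ∈ Finset.range (p + 2), ν i * ζ ^ (i + 1) * u i = 0)
    (h2 : ∑ i ∈ Finset.range (p + 2), ν i * ζ' ^ (i + 1) * u i = 0) :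
    ∑ i ∈ Finset.range (p + 2), ν i * (Chebyshev.U ℂ (i : ℤ)).eval x * u i = 0 := by
  refine (mul_eq_zero.1 (?_ : _ * (ζ - ζ') = 0)).resolve_right (sub_ne_zero.2 hne)
  rw [Finset.sum_mul, ← sub_zero (0 : ℂ)]
  nth_rewrite 1 [← h1]
  rw [← h2, ← Finset.sum_sub_distrib]
  refine Finset.sum_congr rfl fun i _ => ?_
  linear_combination (ν i * u i) * chebyshev_U_eval_mul_sub h hx i

lemma eq_zero_of_sum_mul_chebyshev_U_sq {p : ℕ} {ν : ℕ → ℂ} {S : Set ℂ} (hS : S.Infinite)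
    (h : ∀ t ∈ S, ∑ i ∈ Finset.range p, ν i * (Chebyshev.U ℂ (i : ℤ)).eval t *
      (Chebyshev.U ℂ (i : ℤ)).eval t = 0) : ∀ i < p, ν i = 0 := by
  have hF : ∑ i ∈ Finset.range p, C (ν i) * Chebyshev.U ℂ (i : ℤ) ^ 2 = 0 := by
    refine eq_zero_of_infinite_isRoot _ (hS.mono fun t ht => ?_)
    simp only [Set.mem_ofPred_eq, IsRoot, eval_finsetSum, eval_mul, eval_C, eval_pow]
    rw [← h t ht]
    exact Finset.sum_congr rfl fun i _ => by ring
  clear h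
  induction p with
  | zero => simp
  | succ p ih =>
    have hp : ν p = 0 := by
      have hc := congrArg (coeff · (2 * p)) hF
      simp only [finsetSum_coeff, coeff_C_mul, coeff_zero] at hc
      rw [Finset.sum_range_succ, Finset.sum_eq_zero, zero_add] at hc
      · refine (mul_eq_zero.1 hc).resolve_right ?_
        have : 2 * p = (Chebyshev.U ℂ (p : ℤ) ^ 2).natDegree := by
          rw [natDegree_pow, Chebyshev.natDegree_U_natCast]
        rw [this, coeff_natDegree, leadingCoeff_pow, Chebyshev.leadingCoeff_U_natCast]
        simp
      · intro i hi
        rw [coeff_eq_zero_of_natDegree_lt, mul_zero]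
        rw [natDegree_pow, Chebyshev.natDegree_U_natCast]
        have := Finset.mem_range.1 hi
        omega
    intro i hi
    rcases Nat.lt_succ_iff_lt_or_eq.1 hi with hi | rfl
    · refine ih ?_ i hi
      simpa [Finset.sum_range_succ, hp] using hF
    · exact hp

/-- Along the curve `M(t) = 2 x B(t)`, with `B = U (p + 1)`, the products `U (p - i) (x) * U i (t)`
are linearly independent. -/
lemma eq_zero_of_sum_mul_chebyshev_U_mul {p : ℕ} {ν : ℕ → ℂ} {M : ℂ[X]}
    (hM : ∀ z, (Chebyshev.U ℂ ((p + 1 : ℕ) : ℤ)).eval z = 0 → M.eval z ≠ 0)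
    {S : Set ℂ} (hS : S.Infinite)
    (h : ∀ t ∈ S, ∃ x, (Chebyshev.U ℂ ((p + 1 : ℕ) : ℤ)).eval t ≠ 0 ∧
      M.eval t = 2 * x * (Chebyshev.U ℂ ((p + 1 : ℕ) : ℤ)).eval t ∧
      ∑ i ∈ Finset.range (p + 1), ν i * (Chebyshev.U ℂ ((p - i : ℕ) : ℤ)).eval x *
        (Chebyshev.U ℂ (i : ℤ)).eval t = 0) : ∀ i < p + 1, ν i = 0 := by
  set B := Chebyshev.U ℂ ((p + 1 : ℕ) : ℤ) with hB
  obtain ⟨z, hz, hz'⟩ := exists_chebyshev_U_root (p + 1) (by omega)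
  rw [← hB] at hz
  intro k
  induction k using Nat.strong_induction_on with
  | _ k ih =>
  intro hk
  set F : ℂ[X] := ∑ i ∈ Finset.Ico k (p + 1),
    C (ν i) * (homogU M B (p - i) * B ^ (i - k)) * Chebyshev.U ℂ (i : ℤ) with hF
  have hF0 : F = 0 := by
    refine eq_zero_of_infinite_isRoot _ (hS.mono fun t ht => ?_)
    obtain ⟨x, hBt, hx, hsum⟩ := h t ht
    rw [← Finset.sum_range_add_sum_Ico _ hk.le, Finset.sum_eq_zero, zero_add] at hsum
    · simp only [Set.mem_ofPred_eq, IsRoot, hF, eval_finsetSum, eval_mul, eval_C, eval_pow,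
        eval_homogU hx]
      rw [← mul_zero (B.eval t ^ (p - k)), ← hsum, Finset.mul_sum]
      refine Finset.sum_congr rfl fun i hi => ?_
      have := Finset.mem_Ico.1 hi
      have e : p - k = (p - i) + (i - k) := by omega
      rw [e, pow_add]
      ring
    · intro i hi
      have hi := Finset.mem_range.1 hi
      simp [ih i hi (hi.trans hk)]
  have hev := congrArg (eval z) hF0
  rw [hF, Finset.sum_eq_sum_Ico_succ_bot hk, eval_add, eval_finsetSum,
    Finset.sum_eq_zero, add_zero] at hev
  · simp only [Nat.sub_self, pow_zero, mul_one, eval_mul, eval_C, eval_homogU_of_eq_zero hz,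
      eval_zero] at hev
    rcases mul_eq_zero.1 hev with h' | h'
    · exact (mul_eq_zero.1 h').resolve_right (pow_ne_zero _ (hM z hz))
    · exact absurd h' (hz' k hk)
  · intro i hi
    have := Finset.mem_Ico.1 hi
    have e : i - k ≠ 0 := by omega
    simp [hz, e]

lemma eq_zero_of_sum_mul_pow_chebyshev_U {p : ℕ} {ν : ℕ → ℂ} {a : ℂ} (ha : a ≠ 0) (ha' : a + 1 ≠ 0)
    {S : Set ℂ} (hS : S.Infinite)
    (h : ∀ t ∈ S, ∃ ζ ζ' x : ℂ, ζ * ζ' = 1 ∧ ζ ≠ ζ' ∧ ζ + ζ' = 2 * x ∧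
      (Chebyshev.U ℂ ((p + 1 : ℕ) : ℤ)).eval t ≠ 0 ∧
      (1 - a ^ 2) * (Chebyshev.U ℂ ((p + 2 : ℕ) : ℤ)).eval t =
        2 * a * (x - a * t) * (Chebyshev.U ℂ ((p + 1 : ℕ) : ℤ)).eval t ∧
      ∑ i ∈ Finset.range (p + 2), ν i * ζ ^ (i + 1) * (Chebyshev.U ℂ (i : ℤ)).eval t = 0 ∧
      ∑ i ∈ Finset.range (p + 2), ν i * ζ' ^ (i + 1) * (Chebyshev.U ℂ (i : ℤ)).eval t = 0) :
    ∀ i < p + 2, ν i = 0 := by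
  by_cases ha2 : 1 - a ^ 2 = 0
  · have ha1 : a = 1 := by
      refine (sub_eq_zero.1 ((mul_eq_zero.1 (?_ : (a - 1) * (a + 1) = 0)).resolve_right ha'))
      linear_combination -ha2
    refine eq_zero_of_sum_mul_chebyshev_U_sq hS fun t ht => ?_
    obtain ⟨ζ, ζ', x, h1, hne, hx, hB, hrel, hs, hs'⟩ := h t ht
    have hxt : x = t := by
      rw [ha2, zero_mul, eq_comm, mul_eq_zero, or_iff_left hB, mul_eq_zero,
        or_iff_right (by simpa using ha), sub_eq_zero, ha1, one_mul] at hrel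
      exact hrel
    rw [← hxt] at hs hs' ⊢
    exact sum_chebyshev_U_sq_eq_zero h1 hne hx hs hs'
  · have hlow : ∀ i < p + 1, ν i = 0 := by
      refine eq_zero_of_sum_mul_chebyshev_U_mul
        (M := C (2 * a) * X * Chebyshev.U ℂ ((p + 1 : ℕ) : ℤ) +
          C ((1 - a ^ 2) / a) * Chebyshev.U ℂ ((p + 2 : ℕ) : ℤ)) ?_ hS fun t ht => ?_
      · intro z hz
        have := chebyshev_U_eval_succ_ne_zero hz
        simp only [eval_add, eval_mul, hz, mul_zero, zero_add, eval_C]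
        exact mul_ne_zero (div_ne_zero ha2 ha) this
      · obtain ⟨ζ, ζ', x, h1, hne, hx, hB, hrel, hs, hs'⟩ := h t ht
        refine ⟨x, hB, ?_, ?_⟩
        · simp only [eval_add, eval_mul, eval_C, eval_X]
          field_simp
          linear_combination hrel
        · have hζ : ζ ≠ 0 := left_ne_zero_of_mul_eq_one h1
          have hζ' : ζ' ≠ 0 := right_ne_zero_of_mul_eq_one h1
          refine sum_chebyshev_U_mul_eq_zero h1 hne hx ?_ ?_
          · refine (mul_eq_zero.1 (?_ : ζ * _ = 0)).resolve_left hζ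
            rw [← hs, Finset.mul_sum]
            exact Finset.sum_congr rfl fun i _ => by ring
          · refine (mul_eq_zero.1 (?_ : ζ' * _ = 0)).resolve_left hζ'
            rw [← hs', Finset.mul_sum]
            exact Finset.sum_congr rfl fun i _ => by ring
    intro i hi
    rcases Nat.lt_succ_iff_lt_or_eq.1 hi with hi | rfl
    · exact hlow i hi
    · obtain ⟨t, ht⟩ := hS.nonempty
      obtain ⟨ζ, ζ', x, h1, hne, hx, hB, hrel, hs, hs'⟩ := h t ht
      rw [Finset.sum_range_succ, Finset.sum_eq_zero, zero_add, mul_eq_zero, or_iff_left hB,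
        mul_eq_zero, or_iff_left (pow_ne_zero _ (left_ne_zero_of_mul_eq_one h1))] at hs
      · exact hs
      · intro i hi
        simp [hlow i (Finset.mem_range.1 hi)]

/-- The eigenvector equation of `E' J + E Jᴴ`, for the KMS matrix `J`, becomes a three-term
recurrence in the variable `y = x + J x`. -/
lemma KMS_exists_recurrence {n : ℕ} {a E E' c : ℂ} (ha : star a = a) {x : Fin n → ℂ}
    (h : ∀ j, E' * (KMS n a *ᵥ x) j + E * ((KMS n a)ᴴ *ᵥ x) j = (c - E - E') * x j) :
    ∃ y : ℕ → ℂ, y n = 0 ∧ (∀ j : Fin n, x j = y j - a * y (j + 1)) ∧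
      (∀ j, j + 1 < n → a * (c - E) * y (j + 2) + (E + E' - c * (1 + a ^ 2)) * y (j + 1)
        + a * (c - E') * y j = 0) ∧
      (0 < n → a * (c - E) * y 1 + (E + E' - c) * y 0 = 0) := by
  set y : ℕ → ℂ := fun j => ∑ k : Fin n, if j ≤ (k : ℕ) then a ^ ((k : ℕ) - j) * x k else 0 with hy
  set z : ℕ → ℂ := fun j => ∑ k : Fin n, if (k : ℕ) ≤ j then a ^ (j - (k : ℕ)) * x k else 0 with hz
  have hxs : ∀ j : Fin n, x j = ∑ k : Fin n, if k = j then x k else 0 := by intro j; simp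
  have hxy : ∀ j : Fin n, x j = y j - a * y (j + 1) := by
    intro j
    rw [eq_sub_iff_add_eq]
    nth_rewrite 1 [hxs j]
    rw [hy]
    simp only [Finset.mul_sum, ← Finset.sum_add_distrib]
    refine Finset.sum_congr rfl fun k _ => ?_
    rcases lt_trichotomy (j : ℕ) k with hjk | hjk | hjk
    · rw [if_neg (by rintro rfl; omega), if_pos (by omega), if_pos hjk.le]
      have : (k : ℕ) - j = k - (j + 1) + 1 := by omega
      rw [this, pow_succ]; ring
    · obtain rfl := Fin.ext hjk
      simp
    · rw [if_neg (by rintro rfl; omega), if_neg (by omega), if_neg (by omega)]; simp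
  have hxz0 : ∀ j : Fin n, (j : ℕ) = 0 → x j = z j := by
    intro j hj
    rw [hxs j, hz]
    refine Finset.sum_congr rfl fun k _ => ?_
    by_cases hk : k = j
    · subst hk; simp
    · rw [if_neg hk, if_neg]
      intro hkj
      exact hk (Fin.ext (by omega))
  have hxz : ∀ (j : Fin n) (i : ℕ), (j : ℕ) = i + 1 → x j = z j - a * z i := by
    intro j i hj
    rw [eq_sub_iff_add_eq]
    nth_rewrite 1 [hxs j]
    rw [hz]
    simp only [Finset.mul_sum, ← Finset.sum_add_distrib]
    refine Finset.sum_congr rfl fun k _ => ?_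
    rcases lt_trichotomy (j : ℕ) k with hjk | hjk | hjk
    · rw [if_neg (by rintro rfl; omega), if_neg (by omega), if_neg (by omega)]; simp
    · obtain rfl := Fin.ext hjk
      rw [if_pos rfl, if_neg (by omega)]; simp
    · rw [if_neg (by rintro rfl; omega), if_pos (by omega), if_pos hjk.le]
      have : (j : ℕ) - k = i - k + 1 := by omega
      rw [this, pow_succ]; ring
  have hJ : ∀ j, (KMS n a *ᵥ x) j = y j - x j := by
    intro j
    rw [eq_sub_iff_add_eq]
    nth_rewrite 1 [hxs j]
    simp only [mulVec, dotProduct, hy, ← Finset.sum_add_distrib, KMS, of_apply]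
    refine Finset.sum_congr rfl fun k _ => ?_
    rcases lt_trichotomy (j : ℕ) k with hjk | hjk | hjk
    · rw [if_pos hjk, if_neg (by rintro rfl; omega), if_pos hjk.le, add_zero]
    · obtain rfl := Fin.ext hjk
      simp
    · rw [if_neg (by omega), if_neg (by rintro rfl; omega), if_neg (by omega)]; simp
  have hJ' : ∀ j, ((KMS n a)ᴴ *ᵥ x) j = z j - x j := by
    intro j
    rw [eq_sub_iff_add_eq]
    nth_rewrite 1 [hxs j]
    simp only [mulVec, dotProduct, hz, ← Finset.sum_add_distrib, KMS, of_apply,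
      conjTranspose_apply]
    refine Finset.sum_congr rfl fun k _ => ?_
    rcases lt_trichotomy (j : ℕ) k with hjk | hjk | hjk
    · rw [if_neg (by omega), if_neg (by rintro rfl; omega), if_neg (by omega)]; simp
    · obtain rfl := Fin.ext hjk
      simp
    · rw [if_pos hjk, if_neg (by rintro rfl; omega), if_pos hjk.le, add_zero, star_pow, ha]
  have h' : ∀ j : Fin n, E' * y j + E * z j = c * x j := by
    intro j
    have := h j
    rw [hJ, hJ'] at this
    linear_combination this
  refine ⟨y, ?_, hxy, fun j hj => ?_, fun hn => ?_⟩
  · exact Finset.sum_eq_zero fun k _ => if_neg (by omega)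
  · have e0 := h' ⟨j, by omega⟩
    have e1 := h' ⟨j + 1, hj⟩
    have e2 := hxz ⟨j + 1, hj⟩ j rfl
    have e3 := hxy ⟨j, by omega⟩
    have e4 := hxy ⟨j + 1, hj⟩
    simp only [add_assoc, one_add_one_eq_two] at e0 e1 e2 e3 e4
    rw [e3] at e0
    rw [e4] at e1 e2
    linear_combination e1 - a * e0 + E * e2
  · have e1 := h' ⟨0, hn⟩
    have e2 := hxz0 ⟨0, hn⟩ rfl
    have e4 := hxy ⟨0, hn⟩
    simp only [zero_add] at e1 e2 e4
    rw [e4] at e1 e2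
    linear_combination e1 + E * e2

lemma recurrence_solution {p : ℕ} {y : ℕ → ℂ} {ζ ζ' t : ℂ} (h : ζ * ζ' = 1)
    (h0 : y (p + 2) = 0)
    (hrec : ∀ j, j + 1 < p + 2 → ζ * y (j + 2) - 2 * t * y (j + 1) + ζ' * y j = 0) (k : ℕ)
    (hk : k < p + 2) :
    y (p + 1 - k) = y (p + 1) * ζ' * ζ ^ (k + 1) * (Chebyshev.U ℂ (k : ℤ)).eval t := by
  induction k using Nat.twoStepInduction with
  | zero => simp; linear_combination -(y (p + 1)) * h
  | one =>
    have := hrec p (by omega)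
    simp [h0] at this ⊢
    linear_combination ζ * this - (2 * t * ζ * y (p + 1) + y p) * h
  | more k ih0 ih1 =>
    have ih0 := ih0 (by omega)
    have ih1 := ih1 (by omega)
    obtain ⟨j, rfl⟩ : ∃ j, p = j + k + 1 := ⟨p - 1 - k, by omega⟩
    have := hrec j (by omega)
    rw [show j + k + 1 + 1 - k = j + 2 by omega] at ih0
    rw [show j + k + 1 + 1 - (k + 1) = j + 1 by omega] at ih1
    rw [show j + k + 1 + 1 - (k + 2) = j by omega, chebyshev_U_eval_add_two]
    rw [ih0, ih1] at this
    linear_combination ζ * this - y j * h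

/-- The coefficients of `∑ ω j * (y j - a * y (j + 1))` with respect to `y`. -/
def abelCoeff (a : ℂ) (ω : ℕ → ℂ) : ℕ → ℂ
  | 0 => ω 0
  | j + 1 => ω (j + 1) - a * ω j

lemma sum_abelCoeff_mul (a : ℂ) (ω y : ℕ → ℂ) (n : ℕ) :
    ∑ j ∈ Finset.range (n + 1), ω j * (y j - a * y (j + 1)) =
      ∑ j ∈ Finset.range (n + 1), abelCoeff a ω j * y j - a * ω n * y (n + 1) := by
  induction n with
  | zero => simp [abelCoeff]; ring
  | succ n ih =>
    rw [Finset.sum_range_succ, ih, Finset.sum_range_succ _ (n + 1), abelCoeff]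
    ring

lemma eq_zero_of_abelCoeff_eq_zero {a : ℂ} {ω : ℕ → ℂ} {n : ℕ}
    (h : ∀ j < n, abelCoeff a ω j = 0) : ∀ j < n, ω j = 0 := by
  intro j hj
  induction j with
  | zero => exact h 0 hj
  | succ j ih =>
    have := h (j + 1) hj
    rwa [abelCoeff, ih (by omega), mul_zero, sub_zero] at this

lemma KMS_eigenvector {p : ℕ} {a E E' c s t ζ ζ' : ℂ} (ha : star a = a)
    {x : Fin (p + 2) → ℂ} (hx : x ≠ 0)
    (h : ∀ j, E' * (KMS (p + 2) a *ᵥ x) j + E * ((KMS (p + 2) a)ᴴ *ᵥ x) j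
      = (c - E - E') * x j)
    (hζ : ζ * ζ' = 1) (hs : s ≠ 0) (h1 : a * (c - E) = s * ζ) (h2 : a * (c - E') = s * ζ')
    (h3 : c * (1 + a ^ 2) - E - E' = 2 * t * s) :
    s * (Chebyshev.U ℂ ((p + 2 : ℕ) : ℤ)).eval t =
        c * a ^ 2 * (Chebyshev.U ℂ ((p + 1 : ℕ) : ℤ)).eval t ∧
      ∀ ω : ℕ → ℂ, ∑ j : Fin (p + 2), ω j * x j = 0 →
        ∑ i ∈ Finset.range (p + 2), abelCoeff a ω (p + 1 - i) * ζ ^ (i + 1) *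
          (Chebyshev.U ℂ (i : ℤ)).eval t = 0 := by
  obtain ⟨y, hy0, hxy, hrec, hlast⟩ := KMS_exists_recurrence ha h
  have hsol := recurrence_solution (p := p) (y := y) (t := t) hζ hy0 (fun j hj => by
    refine (mul_eq_zero.1 (?_ : s * _ = 0)).resolve_left hs
    linear_combination hrec j hj - y (j + 2) * h1 - y j * h2 + y (j + 1) * h3)
  set η := y (p + 1) * ζ' with hη
  have hζ0 : ζ ≠ 0 := left_ne_zero_of_mul_eq_one hζ
  have hη0 : η ≠ 0 := by
    intro h0
    have hy : ∀ j < p + 2, y j = 0 := by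
      intro j hj
      have := hsol (p + 1 - j) (by omega)
      rwa [h0, zero_mul, zero_mul, show p + 1 - (p + 1 - j) = j by omega] at this
    refine hx (funext fun j => ?_)
    rw [hxy j, hy j j.2]
    rcases Nat.lt_or_ge (j + 1) (p + 2) with hj | hj
    · simp [hy _ hj]
    · rw [show (j : ℕ) + 1 = p + 2 by omega, hy0]; simp
  constructor
  · have e0 := hsol (p + 1) (by omega)
    have e1 := hsol p (by omega)
    rw [Nat.sub_self] at e0
    rw [Nat.add_sub_cancel_left] at e1
    have e := hlast (by omega)
    rw [e0, e1] at e
    rw [chebyshev_U_eval_add_two, ← sub_eq_zero]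
    refine (mul_eq_zero.1 (?_ : η * ζ ^ (p + 2) * _ = 0)).resolve_left
      (mul_ne_zero hη0 (pow_ne_zero _ hζ0))
    linear_combination
      - e + η * ζ ^ (p + 1) * (Chebyshev.U ℂ (p : ℤ)).eval t * h1
      - η * ζ ^ (p + 2) * (Chebyshev.U ℂ ((p + 1 : ℕ) : ℤ)).eval t * h3
  · intro ω hω
    have e : ∑ j ∈ Finset.range (p + 2), ω j * (y j - a * y (j + 1)) = 0 := by
      rw [Finset.sum_range, ← hω]
      exact Finset.sum_congr rfl fun j _ => by rw [hxy j]
    rw [sum_abelCoeff_mul, hy0, mul_zero, sub_zero, ← Finset.sum_range_reflect] at e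
    refine (mul_eq_zero.1 (?_ : η * _ = 0)).resolve_left hη0
    rw [← e, Finset.mul_sum]
    refine Finset.sum_congr rfl fun i hi => ?_
    rw [show p + 2 - 1 - i = p + 1 - i by omega, hsol i (Finset.mem_range.1 hi)]
    ring

/-- The unit vector `x` attains the maximum of `Re (conj u * ⟨A x, x⟩)` over unit vectors. -/
def AttainsSupport {m : Type*} [Fintype m] (A : Matrix m m ℂ) (u : ℂ) (x : m → ℂ) : Prop :=
  star x ⬝ᵥ x = 1 ∧ ∀ x', star x' ⬝ᵥ x' = 1 →
    (star u * (star x' ⬝ᵥ A *ᵥ x')).re ≤ (star u * (star x ⬝ᵥ A *ᵥ x)).re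

open scoped ComplexOrder in
lemma AttainsSupport.mulVec_eq {m : Type*} [Fintype m] [DecidableEq m] {A : Matrix m m ℂ} {u : ℂ}
    {x : m → ℂ} (h : AttainsSupport A u x) :
    star u • (A *ᵥ x) + u • (Aᴴ *ᵥ x) =
      ((2 * (star u * (star x ⬝ᵥ A *ᵥ x)).re : ℝ) : ℂ) • x := by
  obtain ⟨hx, hmax⟩ := h
  set l : ℝ := (star u * (star x ⬝ᵥ A *ᵥ x)).re with hl
  set M : Matrix m m ℂ := ((2 * l : ℝ) : ℂ) • (1 : Matrix m m ℂ) - (star u • A + u • Aᴴ) with hM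
  have hherm : M.IsHermitian := by
    rw [hM, IsHermitian]
    simp [conjTranspose_sub, conjTranspose_add, conjTranspose_smul, add_comm]
  have hquad : ∀ v : m → ℂ, star v ⬝ᵥ M *ᵥ v =
      2 * l * (star v ⬝ᵥ v) - ((2 * (star u * (star v ⬝ᵥ A *ᵥ v)).re : ℝ) : ℂ) := by
    intro v
    have hadj : star v ⬝ᵥ Aᴴ *ᵥ v = star (star v ⬝ᵥ A *ᵥ v) := by
      rw [star_dotProduct, star_mulVec, conjTranspose_conjTranspose, ← dotProduct_mulVec]
    have hre : ((2 * (star u * (star v ⬝ᵥ A *ᵥ v)).re : ℝ) : ℂ) =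
        star u * (star v ⬝ᵥ A *ᵥ v) + star (star u * (star v ⬝ᵥ A *ᵥ v)) := by
      exact (Complex.add_conj _).symm
    rw [hre, hM, sub_mulVec, add_mulVec, smul_mulVec, smul_mulVec, smul_mulVec, one_mulVec,
      dotProduct_sub, dotProduct_add, dotProduct_smul, dotProduct_smul, dotProduct_smul, hadj]
    simp only [smul_eq_mul, star_mul', star_star]
    push_cast
    ring
  have hpsd : M.PosSemidef := by
    refine .of_dotProduct_mulVec_nonneg hherm fun v => ?_
    rcases eq_or_ne v 0 with rfl | hv
    · simp
    have hpos : 0 < star v ⬝ᵥ v := dotProduct_star_self_pos_iff.2 hv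
    obtain ⟨r, hr⟩ : ∃ r : ℝ, star v ⬝ᵥ v = r := ⟨_, Complex.eq_re_of_ofReal_le hpos.le⟩
    rw [hr, Complex.zero_lt_real] at hpos
    have hsq : (Real.sqrt r)⁻¹ * (Real.sqrt r)⁻¹ = r⁻¹ := by
      rw [← mul_inv, Real.mul_self_sqrt hpos.le]
    set q : ℂ := Complex.ofReal (Real.sqrt r)⁻¹ with hq
    have hqs : star q = q := Complex.conj_ofReal _
    have hqq : q * q = ((r⁻¹ : ℝ) : ℂ) := by rw [hq, ← Complex.ofReal_mul, hsq]
    have hrr : ((r⁻¹ : ℝ) : ℂ) * r = 1 := by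
      rw [← Complex.ofReal_mul, inv_mul_cancel₀ hpos.ne', Complex.ofReal_one]
    have := hmax (q • v) (by
      rw [star_smul, smul_dotProduct, dotProduct_smul, hr, hqs, smul_eq_mul, smul_eq_mul,
        ← mul_assoc, hqq, hrr])
    rw [mulVec_smul, star_smul, smul_dotProduct, dotProduct_smul, hqs, smul_eq_mul, smul_eq_mul,
      ← mul_assoc q, hqq, mul_left_comm, Complex.re_ofReal_mul, inv_mul_le_iff₀ hpos] at this
    rw [hquad, hr]
    norm_cast
    linarith
  have hzero : star x ⬝ᵥ M *ᵥ x = 0 := by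
    rw [hquad, hx, ← hl]; push_cast; ring
  have := (hpsd.dotProduct_mulVec_zero_iff x).1 hzero
  rw [hM, sub_mulVec, add_mulVec, smul_mulVec, smul_mulVec, smul_mulVec, one_mulVec,
    sub_eq_zero] at this
  exact this.symm

lemma KMS_ofReal_conj_form (n : ℕ) (r : ℝ) (x : Fin n → ℂ) :
    star (star x) ⬝ᵥ KMS n r *ᵥ star x = star (star x ⬝ᵥ KMS n r *ᵥ x) := by
  simp only [dotProduct, mulVec, star_sum, star_mul', Pi.star_apply, star_star]
  refine Finset.sum_congr rfl fun i _ => ?_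
  congr 1
  refine Finset.sum_congr rfl fun j _ => ?_
  congr 1
  simp only [KMS, of_apply]
  split_ifs
  · rw [star_pow]; simp
  · simp

lemma AttainsSupport.conj_re_eq {n : ℕ} {r : ℝ} {u : ℂ} {x x' : Fin n → ℂ}
    (h : AttainsSupport (KMS n r) u x) (h' : AttainsSupport (KMS n r) (star u) x') :
    (star u * (star x ⬝ᵥ KMS n r *ᵥ x)).re =
      (star (star u) * (star x' ⬝ᵥ KMS n r *ᵥ x')).re := by
  have hu : ∀ y : Fin n → ℂ, star y ⬝ᵥ y = 1 → star (star y) ⬝ᵥ star y = 1 := by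
    intro y hy
    rw [star_star, dotProduct_comm, hy]
  have key : ∀ (v : ℂ) (y : Fin n → ℂ), (star v * (star (star y) ⬝ᵥ KMS n r *ᵥ star y)).re =
      (v * (star y ⬝ᵥ KMS n r *ᵥ y)).re := by
    intro v y
    rw [KMS_ofReal_conj_form, ← star_mul']
    exact Complex.conj_re _
  have h1 := h.2 (star x') (hu _ h'.1)
  have h2 := h'.2 (star x) (hu _ h.1)
  rw [key] at h1 h2
  rw [star_star] at h2 ⊢
  exact le_antisymm h2 h1

lemma KMS_support_point {p : ℕ} {r : ℝ} (hr : 0 < r) {E : ℂ} (him : 0 < E.im)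
    {ω : ℕ → ℂ} {x₁ x₂ : Fin (p + 2) → ℂ}
    (h₁ : AttainsSupport (KMS (p + 2) r) E x₁) (hω₁ : ∑ j : Fin (p + 2), ω j * x₁ j = 0)
    (h₂ : AttainsSupport (KMS (p + 2) r) (star E) x₂)
    (hω₂ : ∑ j : Fin (p + 2), ω j * x₂ j = 0) :
    ∃ (s t : ℝ) (ζ : ℂ), 0 < s ∧ ζ * star ζ = 1 ∧ ζ.im < 0 ∧
      (Chebyshev.U ℂ ((p + 1 : ℕ) : ℤ)).eval (t : ℂ) ≠ 0 ∧
      E = s * ((Chebyshev.U ℂ ((p + 2 : ℕ) : ℤ)).eval (t : ℂ) /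
        (r ^ 2 * (Chebyshev.U ℂ ((p + 1 : ℕ) : ℤ)).eval (t : ℂ)) - ζ / r) ∧
      (1 - (r : ℂ) ^ 2) * (Chebyshev.U ℂ ((p + 2 : ℕ) : ℤ)).eval (t : ℂ) =
        2 * r * (ζ.re - r * t) * (Chebyshev.U ℂ ((p + 1 : ℕ) : ℤ)).eval (t : ℂ) ∧
      ∑ i ∈ Finset.range (p + 2), abelCoeff r ω (p + 1 - i) * ζ ^ (i + 1) *
        (Chebyshev.U ℂ (i : ℤ)).eval (t : ℂ) = 0 ∧
      ∑ i ∈ Finset.range (p + 2), abelCoeff r ω (p + 1 - i) * (star ζ) ^ (i + 1) *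
        (Chebyshev.U ℂ (i : ℤ)).eval (t : ℂ) = 0 := by
  have hr0 : (r : ℂ) ≠ 0 := by exact_mod_cast hr.ne'
  have hrs : star (r : ℂ) = r := Complex.conj_ofReal r
  have heq₁ := h₁.mulVec_eq
  have heq₂ := h₂.mulVec_eq
  rw [← h₁.conj_re_eq h₂] at heq₂
  set l : ℝ := (star E * (star x₁ ⬝ᵥ KMS (p + 2) r *ᵥ x₁)).re
  have hEE : E + star E = ((2 * E.re : ℝ) : ℂ) := Complex.add_conj E
  obtain ⟨c, hc⟩ : ∃ c : ℝ, c = 2 * l + 2 * E.re := ⟨_, rfl⟩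
  have hcl : ((2 * l : ℝ) : ℂ) = c - E - star E := by
    rw [sub_sub, hEE, hc]; push_cast; ring
  set δ : ℂ := r * (c - E) with hδ
  have hδim : δ.im < 0 := by
    rw [hδ, Complex.im_ofReal_mul, Complex.sub_im, Complex.ofReal_im]
    nlinarith
  have hδ0 : δ ≠ 0 := by
    intro h
    rw [h, Complex.zero_im] at hδim
    exact lt_irrefl _ hδim
  have hδs : r * (c - star E) = star δ := by
    rw [hδ, star_mul', star_sub, hrs]
    congr 2
    exact (Complex.conj_ofReal c).symm
  obtain ⟨s, hs⟩ : ∃ s : ℝ, s = ‖δ‖ := ⟨_, rfl⟩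
  have hs0 : 0 < s := hs ▸ norm_pos_iff.2 hδ0
  have hsc : (s : ℂ) ≠ 0 := by exact_mod_cast hs0.ne'
  have hss : star (s : ℂ) = s := Complex.conj_ofReal s
  obtain ⟨ζ, hζ⟩ : ∃ ζ : ℂ, ζ = δ / s := ⟨_, rfl⟩
  have hsζ : δ = s * ζ := by rw [hζ, mul_div_cancel₀ _ hsc]
  have hsζ' : star δ = s * star ζ := by rw [hsζ, star_mul', hss]
  have hζ1 : ζ * star ζ = 1 := by
    have : δ * star δ = (s : ℂ) ^ 2 := by
      rw [hs]; exact Complex.mul_conj' δ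
    rw [hsζ', hsζ] at this
    refine mul_left_cancel₀ (pow_ne_zero 2 hsc) ?_
    linear_combination this
  have hζim : ζ.im < 0 := by
    rw [hζ, Complex.div_ofReal_im]
    exact div_neg_of_neg_of_pos hδim hs0
  obtain ⟨t, ht⟩ : ∃ t : ℝ, t = (c * (1 + r ^ 2) - 2 * E.re) / (2 * s) := ⟨_, rfl⟩
  have hts : (c : ℂ) * (1 + (r : ℂ) ^ 2) - (E + star E) = 2 * t * s := by
    rw [hEE, ht]
    push_cast
    field_simp
  have hx0 : ∀ {u : ℂ} {x : Fin (p + 2) → ℂ}, AttainsSupport (KMS (p + 2) r) u x → x ≠ 0 := by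
    rintro u x hx rfl
    simpa using hx.1
  obtain ⟨hU, hsum₁⟩ := KMS_eigenvector (c := c) (E := E) (E' := star E) (s := s) (t := t)
    hrs (hx0 h₁)
    (fun j => by
      have := congrFun heq₁ j
      rwa [hcl] at this) hζ1 hsc hsζ (hδs.trans hsζ') (by linear_combination hts)
  obtain ⟨-, hsum₂⟩ := KMS_eigenvector (c := c) (E := star E) (E' := E) (s := s) (t := t)
    hrs (hx0 h₂)
    (fun j => by
      have := congrFun heq₂ j
      rw [hcl, star_star, sub_right_comm] at this
      exact this) (by rw [mul_comm, hζ1]) hsc (hδs.trans hsζ') hsζ (by linear_combination hts)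
  have hB : (Chebyshev.U ℂ ((p + 1 : ℕ) : ℤ)).eval (t : ℂ) ≠ 0 := by
    intro hB
    rw [hB, mul_zero] at hU
    exact mul_ne_zero hsc (chebyshev_U_eval_succ_ne_zero hB) hU
  refine ⟨s, t, ζ, hs0, hζ1, hζim, hB, ?_, ?_, hsum₁ ω hω₁, hsum₂ ω hω₂⟩
  · have e : E = c - s * ζ / r := by
      rw [← hsζ, hδ]; field_simp; ring
    have e' : (c : ℂ) = s * ((Chebyshev.U ℂ ((p + 2 : ℕ) : ℤ)).eval (t : ℂ) /
        (r ^ 2 * (Chebyshev.U ℂ ((p + 1 : ℕ) : ℤ)).eval (t : ℂ))) := by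
      rw [← mul_div_assoc, hU]; field_simp
    rw [mul_sub, ← e', ← mul_div_assoc]
    exact e
  · have hre : ζ + star ζ = 2 * (ζ.re : ℂ) := by
      have : ζ + star ζ = ((2 * ζ.re : ℝ) : ℂ) := Complex.add_conj ζ
      rw [this]; push_cast; rfl
    refine mul_left_cancel₀ hsc ?_
    linear_combination (1 - (r : ℂ) ^ 2) * hU +
      (r * (Chebyshev.U ℂ ((p + 1 : ℕ) : ℤ)).eval (t : ℂ)) *
        (s * hre + hsζ + hsζ' - hδ + hδs - r * hts)

lemma eq_of_unit_of_re_eq {ζ ζ' : ℂ} (h : ζ * star ζ = 1) (h' : ζ' * star ζ' = 1)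
    (him : ζ.im < 0) (him' : ζ'.im < 0) (hre : ζ.re = ζ'.re) : ζ = ζ' := by
  have n : ∀ z : ℂ, z * star z = 1 → z.re ^ 2 + z.im ^ 2 = 1 := by
    intro z hz
    have : z * star z = (Complex.normSq z : ℂ) := Complex.mul_conj z
    rw [this] at hz
    have hz : Complex.normSq z = 1 := by exact_mod_cast hz
    rw [Complex.normSq_apply] at hz
    linarith
  refine Complex.ext hre ?_
  have e1 := n ζ h
  have e2 := n ζ' h'
  rw [hre] at e1
  have : (ζ.im - ζ'.im) * (ζ.im + ζ'.im) = 0 := by linear_combination e1 - e2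
  rcases mul_eq_zero.1 this with h | h <;> linarith

lemma KMS_ofReal_eq_zero_of_orthogonal {p : ℕ} {r : ℝ} (hr : 0 < r) {ω : ℕ → ℂ}
    (h : ∀ E : ℂ, E * star E = 1 → ∃ x, AttainsSupport (KMS (p + 2) r) E x ∧
      ∑ j : Fin (p + 2), ω j * x j = 0) : ∀ j < p + 2, ω j = 0 := by
  set e : ℝ → ℂ := fun τ => ⟨τ, √(1 - τ ^ 2)⟩ with he
  have hpos : ∀ τ ∈ Set.Ioo (0 : ℝ) 1, 0 < 1 - τ ^ 2 := fun τ hτ => by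
    nlinarith [hτ.1, hτ.2]
  have he1 : ∀ τ ∈ Set.Ioo (0 : ℝ) 1, e τ * star (e τ) = 1 := by
    intro τ hτ
    have : e τ * star (e τ) = (Complex.normSq (e τ) : ℂ) := Complex.mul_conj _
    rw [this, Complex.normSq_apply, he]
    simp only
    rw [Real.mul_self_sqrt (hpos τ hτ).le]
    push_cast
    ring
  have he2 : ∀ τ ∈ Set.Ioo (0 : ℝ) 1, star (e τ) * star (star (e τ)) = 1 := fun τ hτ => by
    rw [star_star, mul_comm, he1 τ hτ]
  choose! x hx hxω using h
  have hpt := fun τ (hτ : τ ∈ Set.Ioo (0 : ℝ) 1) =>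
    KMS_support_point (E := e τ) hr (Real.sqrt_pos.2 (hpos τ hτ)) (hx _ (he1 τ hτ))
      (hxω _ (he1 τ hτ)) (hx _ (he2 τ hτ)) (hxω _ (he2 τ hτ))
  choose! s t ζ hs hζ hζim hB hE hrel hsum hsum' using hpt
  have hr0 : (r : ℂ) ≠ 0 := by exact_mod_cast hr.ne'
  have hinj : Set.InjOn (fun τ => (t τ : ℂ)) (Set.Ioo 0 1) := by
    intro τ hτ τ' hτ' ht
    have ht : t τ = t τ' := Complex.ofReal_injective ht
    have hre : (ζ τ).re = (ζ τ').re := by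
      have e1 := hrel τ hτ
      have e2 := hrel τ' hτ'
      have hb := hB τ hτ
      rw [← ht] at e2
      have := mul_right_cancel₀ hb (e1.symm.trans e2)
      have := mul_left_cancel₀ (mul_ne_zero two_ne_zero hr0) this
      exact_mod_cast sub_left_inj.1 this
    have hζζ := eq_of_unit_of_re_eq (hζ τ hτ) (hζ τ' hτ') (hζim τ hτ) (hζim τ' hτ') hre
    have e1 := hE τ hτ
    have e2 := hE τ' hτ'
    rw [← ht, ← hζζ] at e2
    set κ := eval (t τ : ℂ) (Chebyshev.U ℂ ((p + 2 : ℕ) : ℤ)) /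
      (r ^ 2 * eval (t τ : ℂ) (Chebyshev.U ℂ ((p + 1 : ℕ) : ℤ))) - ζ τ / r
    have hnorm : ∀ τ ∈ Set.Ioo (0 : ℝ) 1, ‖e τ‖ = 1 := by
      intro τ hτ
      have := he1 τ hτ
      have h2 : e τ * star (e τ) = (‖e τ‖ : ℂ) ^ 2 := Complex.mul_conj' _
      rw [h2] at this
      have : ‖e τ‖ ^ 2 = 1 := by exact_mod_cast this
      exact (pow_eq_one_iff_of_nonneg (norm_nonneg _) two_ne_zero).1 this
    have n1 := hnorm τ hτ
    have n2 := hnorm τ' hτ'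
    rw [e1, norm_mul, Complex.norm_of_nonneg (hs τ hτ).le] at n1
    rw [e2, norm_mul, Complex.norm_of_nonneg (hs τ' hτ').le] at n2
    have hκ : ‖κ‖ ≠ 0 := right_ne_zero_of_mul (n1.trans_ne one_ne_zero)
    have hss : s τ = s τ' := mul_right_cancel₀ hκ (n1.trans n2.symm)
    rw [← hss, ← e1] at e2
    exact (congrArg Complex.re e2).symm
  have hν := eq_zero_of_sum_mul_pow_chebyshev_U (p := p)
    (ν := fun i => abelCoeff r ω (p + 1 - i)) hr0 (by exact_mod_cast (by positivity : r + 1 ≠ 0))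
    ((Set.Ioo_infinite zero_lt_one).image hinj) (by
      rintro _ ⟨τ, hτ, rfl⟩
      refine ⟨ζ τ, star (ζ τ), (ζ τ).re, hζ τ hτ, ?_, ?_, hB τ hτ, hrel τ hτ, hsum τ hτ,
        hsum' τ hτ⟩
      · intro hc
        have := Complex.conj_eq_iff_im.1 hc.symm
        exact (hζim τ hτ).ne this
      · have : ζ τ + star (ζ τ) = ((2 * (ζ τ).re : ℝ) : ℂ) := Complex.add_conj _
        rw [this]; push_cast; rfl)
  refine eq_zero_of_abelCoeff_eq_zero (a := r) fun j hj => ?_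
  have := hν (p + 1 - j) (by omega)
  rwa [show p + 1 - (p + 1 - j) = j by omega] at this

/-- `J_n(a)` is diagonally unitarily equivalent to `J_n(|a|)`. -/
lemma KMS_eq_conj_diagonal (n : ℕ) {a : ℂ} (ha : a ≠ 0) :
    ∃ d : Fin n → ℂ, (∀ j, star (d j) * d j = 1) ∧
      KMS n a = (diagonal d)ᴴ * KMS n (‖a‖ : ℝ) * diagonal d := by
  have hn : (‖a‖ : ℂ) ≠ 0 := by exact_mod_cast norm_ne_zero_iff.2 ha
  obtain ⟨u, hu⟩ : ∃ u : ℂ, u = a / ‖a‖ := ⟨_, rfl⟩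
  have hau : a = ‖a‖ * u := by rw [hu, mul_div_cancel₀ _ hn]
  have huu : star u * u = 1 := by
    have : star u * u = (‖u‖ : ℂ) ^ 2 := Complex.conj_mul' u
    rw [this, hu, norm_div, Complex.norm_real, norm_norm, div_self (norm_ne_zero_iff.2 ha)]
    simp
  have hd : ∀ j : ℕ, star (u ^ j) * u ^ j = 1 := fun j => by
    rw [star_pow, ← mul_pow, huu, one_pow]
  refine ⟨fun j => u ^ (j : ℕ), fun j => hd j, ?_⟩
  ext j k
  rw [mul_diagonal, diagonal_conjTranspose, diagonal_mul]
  simp only [KMS, of_apply, Pi.star_apply]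
  split_ifs with hjk
  · obtain ⟨i, hi⟩ := Nat.exists_eq_add_of_lt hjk
    nth_rewrite 1 [hau]
    rw [hi, show (j : ℕ) + i + 1 - j = i + 1 by omega, add_assoc, pow_add u j, mul_pow]
    linear_combination (-(‖a‖ : ℂ) ^ (i + 1) * u ^ (i + 1)) * hd j
  · simp

lemma dotProduct_compression {m n : Type*} [Fintype m] [Fintype n] (V : Matrix n m ℂ)
    (A : Matrix n n ℂ) (y : m → ℂ) :
    star (V *ᵥ y) ⬝ᵥ A *ᵥ (V *ᵥ y) = star y ⬝ᵥ (Vᴴ * A * V) *ᵥ y := by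
  rw [star_mulVec, ← dotProduct_mulVec, mulVec_mulVec, mulVec_mulVec]

lemma dotProduct_mulVec_of_isometry {m n : Type*} [Fintype m] [Fintype n] [DecidableEq m]
    {V : Matrix n m ℂ} (hV : Vᴴ * V = 1) (y : m → ℂ) :
    star (V *ᵥ y) ⬝ᵥ (V *ᵥ y) = star y ⬝ᵥ y := by
  rw [star_mulVec, ← dotProduct_mulVec, mulVec_mulVec, hV, one_mulVec]

lemma AttainsSupport.mulVec_of_conj {m : Type*} [Fintype m] [DecidableEq m] {A U : Matrix m m ℂ}
    (hU : Uᴴ * U = 1) {u : ℂ} {x : m → ℂ} (hx : AttainsSupport (Uᴴ * A * U) u x) :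
    AttainsSupport A u (U *ᵥ x) := by
  obtain ⟨hx, hmax⟩ := hx
  refine ⟨by rw [dotProduct_mulVec_of_isometry hU, hx], fun x' hx' => ?_⟩
  obtain ⟨y, rfl⟩ : ∃ y, x' = U *ᵥ y :=
    ⟨Uᴴ *ᵥ x', by rw [mulVec_mulVec, mul_eq_one_comm.1 hU, one_mulVec]⟩
  rw [dotProduct_mulVec_of_isometry hU] at hx'
  rw [dotProduct_compression, dotProduct_compression]
  exact hmax y hx'

lemma eq_zero_of_orthogonal_KMS {p : ℕ} {a : ℂ} (ha : a ≠ 0) {w : Fin (p + 2) → ℂ}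
    (h : ∀ E : ℂ, E * star E = 1 → ∃ x, AttainsSupport (KMS (p + 2) a) E x ∧
      star w ⬝ᵥ x = 0) : w = 0 := by
  obtain ⟨d, hd, hK⟩ := KMS_eq_conj_diagonal (p + 2) ha
  have hd' : ∀ j, d j * star (d j) = 1 := fun j => by rw [mul_comm, hd]
  have hUU : (diagonal d)ᴴ * diagonal d = 1 := by
    rw [diagonal_conjTranspose, diagonal_mul_diagonal, ← diagonal_one]
    exact congrArg _ (funext hd)
  obtain ⟨ω, hω⟩ : ∃ ω : ℕ → ℂ, ∀ j : Fin (p + 2), ω j = star (w j) * star (d j) :=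
    ⟨fun j => if hj : j < p + 2 then star (w ⟨j, hj⟩) * star (d ⟨j, hj⟩) else 0,
      fun j => by simp⟩
  have h0 := KMS_ofReal_eq_zero_of_orthogonal (p := p) (norm_pos_iff.2 ha) (ω := ω)
    fun E hE => by
      obtain ⟨x, hx, hwx⟩ := h E hE
      rw [hK] at hx
      refine ⟨diagonal d *ᵥ x, AttainsSupport.mulVec_of_conj hUU hx, ?_⟩
      rw [← hwx, dotProduct]
      refine Finset.sum_congr rfl fun j _ => ?_
      rw [hω, mulVec_diagonal, Pi.star_apply]
      linear_combination (star (w j) * x j) * hd j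
  funext j
  have := h0 j j.2
  rw [hω] at this
  exact star_eq_zero.1 ((mul_eq_zero.1 this).resolve_right (right_ne_zero_of_mul_eq_one (hd' j)))

lemma isCompact_dotProduct_unitSphere (n : ℕ) :
    IsCompact {x : Fin n → ℂ | star x ⬝ᵥ x = 1} := by
  refine Metric.isCompact_of_isClosed_isBounded (isClosed_eq (by fun_prop) (by fun_prop))
    ((Metric.isBounded_closedBall (x := 0) (r := 1)).subset fun x hx => ?_)
  rw [mem_closedBall_zero_iff, pi_norm_le_iff_of_nonneg zero_le_one]
  intro i
  have hx : ∑ j, ‖x j‖ ^ 2 = 1 := by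
    have h : star x ⬝ᵥ x = 1 := hx
    rw [dotProduct] at h
    have e : ∀ j, star x j * x j = ((‖x j‖ ^ 2 : ℝ) : ℂ) := fun j => by
      rw [Complex.ofReal_pow]
      exact Complex.conj_mul' (x j)
    simp only [e] at h
    exact_mod_cast h
  have := Finset.single_le_sum (f := fun j => ‖x j‖ ^ 2) (fun j _ => sq_nonneg _)
    (Finset.mem_univ i)
  rw [hx] at this
  exact (sq_le_one_iff₀ (norm_nonneg _)).1 this

lemma exists_attainsSupport {n : ℕ} (hn : 0 < n) (A : Matrix (Fin n) (Fin n) ℂ) (u : ℂ) :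
    ∃ x, AttainsSupport A u x := by
  obtain ⟨x, hx, hmax⟩ := (isCompact_dotProduct_unitSphere n).exists_isMaxOn
    (f := fun x => (star u * (star x ⬝ᵥ A *ᵥ x)).re)
    ⟨Pi.single ⟨0, hn⟩ 1, by simp⟩
    (Complex.continuous_re.comp (by fun_prop)).continuousOn
  exact ⟨x, hx, fun x' hx' => hmax hx'⟩

lemma exists_conjTranspose_mulVec_eq_zero {n m : ℕ} (hmn : m < n)
    (V : Matrix (Fin n) (Fin m) ℂ) : ∃ w ≠ 0, Vᴴ *ᵥ w = 0 := by
  have hker : LinearMap.ker Vᴴ.mulVecLin ≠ ⊥ :=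
    LinearMap.ker_ne_bot_of_finrank_lt (by simpa using hmn)
  obtain ⟨w, hw, hw0⟩ := Submodule.exists_mem_ne_zero_of_ne_bot hker
  exact ⟨w, hw0, by simpa using hw⟩

/-- If `1 ≤ m < n`, `a ≠ 0`, and `A = Vᴴ (J_n(a)) V` is an `m×m` compression of `J_n(a)`
(`VᴴV = I`), then `W(A)` is a proper subset of `W(J_n(a))`. -/
theorem stmt_12 (n m : ℕ) (hm : 1 ≤ m) (hmn : m < n) (a : ℂ) (ha : a ≠ 0)
    (V : Matrix (Fin n) (Fin m) ℂ) (hV : Vᴴ * V = 1) :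
    numRange (Vᴴ * KMS n a * V) ⊆ numRange (KMS n a) ∧
      numRange (Vᴴ * KMS n a * V) ≠ numRange (KMS n a) := by
  refine ⟨?_, fun heq => ?_⟩
  · rintro z ⟨y, hy, rfl⟩
    exact ⟨V *ᵥ y, by rw [dotProduct_mulVec_of_isometry hV, hy], dotProduct_compression _ _ _⟩
  · obtain ⟨p, rfl⟩ : ∃ p, n = p + 2 := ⟨n - 2, by omega⟩
    obtain ⟨w, hw0, hw⟩ := exists_conjTranspose_mulVec_eq_zero hmn V
    refine hw0 (eq_zero_of_orthogonal_KMS ha fun E _ => ?_)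
    obtain ⟨x, hx, hmax⟩ := exists_attainsSupport (by omega) (KMS (p + 2) a) E
    obtain ⟨y, hy, hyx⟩ := heq.symm.subset ⟨x, hx, rfl⟩
    refine ⟨V *ᵥ y, ⟨by rw [dotProduct_mulVec_of_isometry hV, hy], fun x' hx' => ?_⟩, ?_⟩
    · rw [dotProduct_compression, hyx]
      exact hmax x' hx'
    · rw [dotProduct_mulVec, ← conjTranspose_conjTranspose V, ← star_mulVec, hw, star_zero,
        zero_dotProduct]
end

section
/- Let a ∈ ℂ with a ≠ 0 and let x be a unit vector in ℂ^n such that λ = ⟨J_n(a)x, x⟩ lies on the boundary ∂W(J_n(a)) but λ does not lie on any nondegenerate line segment contained in ∂W(J_n(a)). Then x is a cyclic vector for J_n(a), i.e., the span of {x, J_n(a)x, J_n(a)²x, …, J_n(a)^{n−1}x} is all of ℂ^n. -/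
open Matrix

open scoped ComplexOrder in
theorem mem_numRange_of_eq_mul {m : Type*} [Fintype m] {A : Matrix m m ℂ} {v : m → ℂ} {z : ℂ}
    (hv : v ≠ 0) (h : star v ⬝ᵥ (A *ᵥ v) = z * (star v ⬝ᵥ v)) : z ∈ numRange A := by
  have hpos : 0 < star v ⬝ᵥ v := dotProduct_star_self_pos_iff.2 hv
  obtain ⟨hre, him⟩ := Complex.lt_def.1 hpos
  have hreal : star v ⬝ᵥ v = (((star v ⬝ᵥ v).re : ℝ) : ℂ) :=
    Complex.ext (by simp) (by simpa using him.symm)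
  set r : ℝ := (star v ⬝ᵥ v).re with hr
  have hr0 : 0 < r := by simpa using hre
  have hs : (((√r)⁻¹ : ℝ) : ℂ) * (((√r)⁻¹ : ℝ) : ℂ) * (r : ℂ) = 1 := by
    rw [← Complex.ofReal_mul, ← Complex.ofReal_mul, ← mul_inv, Real.mul_self_sqrt hr0.le,
      inv_mul_cancel₀ hr0.ne', Complex.ofReal_one]
  refine ⟨(((√r)⁻¹ : ℝ) : ℂ) • v, ?_, ?_⟩
  · simp only [star_smul, smul_dotProduct, dotProduct_smul, smul_eq_mul, Complex.star_def,
      Complex.conj_ofReal]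
    rw [hreal, ← mul_assoc, hs]
  · simp only [star_smul, smul_dotProduct, dotProduct_smul, mulVec_smul, smul_eq_mul,
      Complex.star_def, Complex.conj_ofReal]
    rw [h, hreal]
    linear_combination z * hs

theorem exists_norm_eq_one_mul_im_eq_zero (w : ℂ) : ∃ c : ℂ, star c * c = 1 ∧ (c * w).im = 0 := by
  by_cases hw : w = 0
  · exact ⟨1, by simp, by simp [hw]⟩
  · have hn : ((‖w‖ : ℝ) : ℂ) ≠ 0 := by simpa using hw
    have hc : star w * w = (‖w‖ : ℂ) * ‖w‖ := by
      rw [Complex.star_def, mul_comm, Complex.mul_conj, Complex.normSq_eq_norm_sq]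
      push_cast; ring
    refine ⟨star w / ‖w‖, ?_, ?_⟩
    · simp only [star_div₀, Complex.star_def, Complex.conj_ofReal] at hc ⊢
      rw [Complex.conj_conj]
      field_simp
      linear_combination hc
    · rw [div_mul_eq_mul_div, hc, mul_div_assoc, div_self hn, mul_one, Complex.ofReal_im]

/-- The **Toeplitz–Hausdorff theorem**: the numerical range of a matrix is convex. -/
theorem convex_numRange {m : Type*} [Fintype m] (A : Matrix m m ℂ) : Convex ℝ (numRange A) := by
  rw [convex_iff_segment_subset]
  rintro z₁ ⟨u, hu, huz⟩ z₂ ⟨v, hv, hvz⟩ z hz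
  rw [segment_eq_image] at hz
  obtain ⟨t, ⟨ht0, ht1⟩, rfl⟩ := hz
  by_cases hne : z₁ = z₂
  · subst hne
    refine ⟨u, hu, ?_⟩
    simp only [huz, ← add_smul]; simp
  have hd : z₂ - z₁ ≠ 0 := sub_ne_zero.2 (Ne.symm hne)
  set p := (star u ⬝ᵥ (A *ᵥ v) - z₁ * (star u ⬝ᵥ v)) / (z₂ - z₁) with hp
  set q := (star v ⬝ᵥ (A *ᵥ u) - z₁ * (star v ⬝ᵥ u)) / (z₂ - z₁) with hq
  obtain ⟨c, hc, hcim⟩ := exists_norm_eq_one_mul_im_eq_zero (p - star q)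
  have hreal : c * p + star c * q = (((c * p + star c * q).re : ℝ) : ℂ) := by
    refine Complex.ext (by simp) ?_
    simp at hcim ⊢
    linarith
  set k := (c * p + star c * q).re with hk
  have hvu : star v ⬝ᵥ u = star (star u ⬝ᵥ v) := by
    rw [star_dotProduct]
  have hreal' : c * (star u ⬝ᵥ v) + star c * (star v ⬝ᵥ u)
      = ((2 * (c * (star u ⬝ᵥ v)).re : ℝ) : ℂ) := by
    rw [hvu]
    refine Complex.ext ?_ ?_ <;> simp <;> ring
  set l := (c * (star u ⬝ᵥ v)).re with hl
  have hnorm : ∀ τ : ℝ, star ((1 - τ : ℂ) • u + ((τ : ℂ) * c) • v) ⬝ᵥ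
      ((1 - τ : ℂ) • u + ((τ : ℂ) * c) • v) =
      (((1 - τ) ^ 2 + τ ^ 2 + (1 - τ) * τ * (2 * l) : ℝ) : ℂ) := by
    intro τ
    simp only [star_add, star_smul, add_dotProduct, dotProduct_add, smul_dotProduct,
      dotProduct_smul, smul_eq_mul, star_mul', star_sub, star_one, hu, hv]
    have : star (τ : ℂ) = τ := Complex.conj_ofReal τ
    rw [this]
    push_cast at hreal' ⊢
    linear_combination (1 - τ : ℂ) * τ * hreal' + (τ : ℂ) ^ 2 * hc
  have hform : ∀ τ : ℝ, star ((1 - τ : ℂ) • u + ((τ : ℂ) * c) • v) ⬝ᵥ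
      (A *ᵥ ((1 - τ : ℂ) • u + ((τ : ℂ) * c) • v)) =
      z₁ * (star ((1 - τ : ℂ) • u + ((τ : ℂ) * c) • v) ⬝ᵥ
        ((1 - τ : ℂ) • u + ((τ : ℂ) * c) • v)) +
      (z₂ - z₁) * ((τ ^ 2 + (1 - τ) * τ * k : ℝ) : ℂ) := by
    intro τ
    have hp' : star u ⬝ᵥ (A *ᵥ v) = z₁ * (star u ⬝ᵥ v) + (z₂ - z₁) * p := by
      rw [hp]; field_simp; ring
    have hq' : star v ⬝ᵥ (A *ᵥ u) = z₁ * (star v ⬝ᵥ u) + (z₂ - z₁) * q := by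
      rw [hq]; field_simp; ring
    simp only [star_add, star_smul, add_dotProduct, dotProduct_add, smul_dotProduct, mulVec_add,
      mulVec_smul, dotProduct_smul, smul_eq_mul, star_mul', star_sub, star_one, hu, hv, huz, hvz,
      hp', hq']
    have : star (τ : ℂ) = τ := Complex.conj_ofReal τ
    rw [this]
    push_cast
    linear_combination (z₂ - z₁) * (1 - τ : ℂ) * τ * hreal + (z₂ - z₁) * (τ : ℂ) ^ 2 * hc
  obtain ⟨τ, -, hτ⟩ : (0 : ℝ) ∈ (fun τ : ℝ => τ ^ 2 + (1 - τ) * τ * k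
      - t * ((1 - τ) ^ 2 + τ ^ 2 + (1 - τ) * τ * (2 * l))) '' Set.Icc 0 1 := by
    apply intermediate_value_Icc zero_le_one
    · fun_prop
    · constructor <;> simp <;> linarith
  have hτ' : ((τ ^ 2 + (1 - τ) * τ * k : ℝ) : ℂ) =
      (t : ℂ) * (((1 - τ) ^ 2 + τ ^ 2 + (1 - τ) * τ * (2 * l) : ℝ) : ℂ) := by
    rw [← Complex.ofReal_mul]
    congr 1
    simpa [sub_eq_zero] using hτ
  refine mem_numRange_of_eq_mul (v := (1 - τ : ℂ) • u + ((τ : ℂ) * c) • v) ?_ ?_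
  · intro h0
    have hu' : (1 - τ : ℂ) • u = (-((τ : ℂ) * c)) • v := by
      rw [neg_smul]; exact eq_neg_of_add_eq_zero_left h0
    have hsc : ∀ (α : ℂ) (w : m → ℂ), star (α • w) ⬝ᵥ (A *ᵥ (α • w)) - z₁ *
        (star (α • w) ⬝ᵥ (α • w)) = star α * α * (star w ⬝ᵥ (A *ᵥ w) - z₁ * (star w ⬝ᵥ w)) := by
      intro α w
      simp only [star_smul, smul_dotProduct, dotProduct_smul, mulVec_smul, smul_eq_mul]
      ring
    have h1 := hsc (1 - τ) u
    rw [hu', hsc, huz, hu, hvz, hv] at h1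
    have h2 : (τ : ℂ) ^ 2 * (z₂ - z₁) = 0 := by
      have : star (τ : ℂ) = τ := Complex.conj_ofReal τ
      simp only [star_neg, star_mul', this] at h1
      linear_combination h1 - (τ : ℂ) ^ 2 * (z₂ - z₁) * hc
    have h3 : (τ : ℂ) = 0 := by simpa [hd] using h2
    rw [h3] at h0
    have h4 : u = 0 := by simpa using h0
    simp [h4] at hu
  · rw [hform, hτ', hnorm]
    simp only [Complex.real_smul]
    push_cast
    ring

/-- A boundary point of a convex set lying on no nondegenerate boundary segment is the only
maximizer of some linear functional on that set. -/
theorem Convex.exists_forall_le_and_eq_of_mem_frontier {E : Type*} [NormedAddCommGroup E]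
    [NormedSpace ℝ E] {s : Set E} (hs : Convex ℝ s) {p : E} (hp : p ∈ s) (hfr : p ∈ frontier s)
    (hseg : ¬ ∃ z w : E, z ≠ w ∧ p ∈ segment ℝ z w ∧ segment ℝ z w ⊆ frontier s) :
    ∃ f : StrongDual ℝ E, ∀ w ∈ s, f w ≤ f p ∧ (f w = f p → w = p) := by
  have key : ∀ f : StrongDual ℝ E, (∀ w ∈ s, f w ≤ f p) → (∀ w ∈ interior s, f w ≠ f p) →
      ∀ w ∈ s, f w ≤ f p ∧ (f w = f p → w = p) := by
    refine fun f hf hint w hw => ⟨hf w hw, fun hwp => ?_⟩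
    by_contra hne
    refine hseg ⟨p, w, Ne.symm hne, left_mem_segment ℝ p w, fun z hz => ?_⟩
    refine ⟨subset_closure (hs.segment_subset hp hw hz), fun hzi => hint z hzi ?_⟩
    obtain ⟨α, β, -, -, hαβ, rfl⟩ := hz
    simp only [map_add, map_smul, smul_eq_mul, hwp]
    rw [← add_mul, hαβ, one_mul]
  by_cases hne : (interior s).Nonempty
  · obtain ⟨f, hf0, hf⟩ := geometric_hahn_banach_of_nonempty_interior_point hs hfr.2 hne
    refine ⟨f, key f hf fun w hw hwp => hf0 ?_⟩
    have hmax : IsLocalMax f w := by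
      filter_upwards [mem_interior_iff_mem_nhds.1 hw] with z hz
      exact (hf z hz).trans hwp.ge
    exact hmax.hasFDerivAt_eq_zero f.hasFDerivAt
  · exact ⟨0, key 0 (by simp) fun w hw => (hne ⟨w, hw⟩).elim⟩

open scoped ComplexOrder in
/-- Two vectors at which the quadratic form of `A` attains the same exposed point `p` of the
numerical range satisfy `⟨Ax, y⟩ = p ⟨x, y⟩`. -/
theorem dotProduct_mulVec_eq_of_exposed {m : Type*} [Fintype m] {A : Matrix m m ℂ} {p : ℂ}
    {f : StrongDual ℝ ℂ} (hf : ∀ w ∈ numRange A, f w ≤ f p ∧ (f w = f p → w = p))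
    {x y : m → ℂ} (hx : star x ⬝ᵥ (A *ᵥ x) = p * (star x ⬝ᵥ x))
    (hy : star y ⬝ᵥ (A *ᵥ y) = p * (star y ⬝ᵥ y)) :
    star y ⬝ᵥ (A *ᵥ x) = p * (star y ⬝ᵥ x) := by
  have hle : ∀ v : m → ℂ, f (star v ⬝ᵥ (A *ᵥ v) - p * (star v ⬝ᵥ v)) ≤ 0 ∧
      (f (star v ⬝ᵥ (A *ᵥ v) - p * (star v ⬝ᵥ v)) = 0 →
        star v ⬝ᵥ (A *ᵥ v) - p * (star v ⬝ᵥ v) = 0) := by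
    intro v
    by_cases hv : v = 0
    · simp [hv]
    have hpos : 0 < star v ⬝ᵥ v := dotProduct_star_self_pos_iff.2 hv
    obtain ⟨hre, him⟩ := Complex.lt_def.1 hpos
    have hreal : star v ⬝ᵥ v = (((star v ⬝ᵥ v).re : ℝ) : ℂ) :=
      Complex.ext (by simp) (by simpa using him.symm)
    set r : ℝ := (star v ⬝ᵥ v).re with hr
    have hr0 : 0 < r := by simpa using hre
    have hrc : (r : ℂ) ≠ 0 := by exact_mod_cast hr0.ne'
    have hmem : (star v ⬝ᵥ (A *ᵥ v)) / r ∈ numRange A :=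
      mem_numRange_of_eq_mul hv (by rw [hreal, div_mul_cancel₀ _ hrc])
    have heq : star v ⬝ᵥ (A *ᵥ v) - p * (star v ⬝ᵥ v) =
        r • ((star v ⬝ᵥ (A *ᵥ v)) / r - p) := by
      rw [hreal, Complex.real_smul]; field_simp
    obtain ⟨h1, h2⟩ := hf _ hmem
    rw [heq, map_smul, map_sub, smul_eq_mul]
    refine ⟨mul_nonpos_of_nonneg_of_nonpos hr0.le (sub_nonpos.2 h1), fun h => ?_⟩
    rw [h2 (sub_eq_zero.1 ((mul_eq_zero.1 h).resolve_left hr0.ne')), sub_self, smul_zero]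
  have hexp : ∀ c : ℂ, star (x + c • y) ⬝ᵥ (A *ᵥ (x + c • y)) - p * (star (x + c • y) ⬝ᵥ
      (x + c • y)) = c * (star x ⬝ᵥ (A *ᵥ y) - p * (star x ⬝ᵥ y)) +
      star c * (star y ⬝ᵥ (A *ᵥ x) - p * (star y ⬝ᵥ x)) := by
    intro c
    simp only [star_add, star_smul, add_dotProduct, dotProduct_add, smul_dotProduct, mulVec_add,
      mulVec_smul, dotProduct_smul, smul_eq_mul]
    linear_combination hx + c * star c * hy
  have hzero : ∀ c : ℂ, c * (star x ⬝ᵥ (A *ᵥ y) - p * (star x ⬝ᵥ y)) +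
      star c * (star y ⬝ᵥ (A *ᵥ x) - p * (star y ⬝ᵥ x)) = 0 := by
    intro c
    have h1 := hle (x + c • y)
    have h2 := (hle (x + (-c) • y)).1
    rw [hexp] at h1 h2
    rw [star_neg, neg_mul, neg_mul, ← neg_add, map_neg] at h2
    exact h1.2 (by linarith [h1.1])
  have h1 := hzero 1
  have h2 := hzero Complex.I
  simp only [star_one, Complex.star_def, Complex.conj_I] at h1 h2
  have h3 : Complex.I * (2 * (star y ⬝ᵥ (A *ᵥ x) - p * (star y ⬝ᵥ x))) = 0 := by
    linear_combination Complex.I * h1 - h2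
  simpa [sub_eq_zero] using h3

theorem kms_succ_succ {n : ℕ} (a : ℂ) (j k : Fin n) :
    KMS (n + 1) a j.succ k.succ = KMS (n + 1) a j.castSucc k.castSucc := by
  simp [KMS]

theorem kms_succ {n : ℕ} (a : ℂ) (j : Fin (n + 1)) (k : Fin n) :
    KMS (n + 1) a j k.succ =
      a * ((if j = k.castSucc then 1 else 0) + KMS (n + 1) a j k.castSucc) := by
  simp only [KMS, of_apply, Fin.val_succ, Fin.val_castSucc, Fin.ext_iff]
  rcases lt_trichotomy (j : ℕ) k with h | h | h
  · rw [if_pos (by omega), if_neg h.ne, if_pos h, Nat.succ_sub h.le, pow_succ]; ring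
  · simp [h]
  · rw [if_neg (by omega), if_neg h.ne', if_neg (by omega)]; simp

/-- The shift of `x` by one coordinate, dropping the last one. -/
def shiftVec {n : ℕ} (x : Fin (n + 1) → ℂ) : Fin (n + 1) → ℂ :=
  Fin.cons 0 fun j => x j.castSucc

theorem star_shiftVec_dotProduct {n : ℕ} {x : Fin (n + 1) → ℂ} (hx : x (Fin.last n) = 0) :
    star (shiftVec x) ⬝ᵥ shiftVec x = star x ⬝ᵥ x := by
  simp only [dotProduct]
  rw [Fin.sum_univ_succ, Fin.sum_univ_castSucc]
  simp [shiftVec, hx]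

theorem kms_mulVec_shiftVec {n : ℕ} (a : ℂ) {x : Fin (n + 1) → ℂ} (hx : x (Fin.last n) = 0) :
    KMS (n + 1) a *ᵥ shiftVec x = a • (x + KMS (n + 1) a *ᵥ x) := by
  ext j
  simp only [mulVec, dotProduct, Pi.smul_apply, Pi.add_apply, smul_eq_mul]
  have hxj : x j = ∑ k : Fin n, (if j = k.castSucc then 1 else 0) * x k.castSucc := by
    have := Fin.sum_univ_castSucc fun k : Fin (n + 1) => (if j = k then 1 else 0) * x k
    simpa [hx] using this
  rw [Fin.sum_univ_succ, Fin.sum_univ_castSucc (fun k => KMS (n + 1) a j k * x k), hx, hxj]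
  simp only [shiftVec, Fin.cons_zero, Fin.cons_succ, mul_zero, zero_add, add_zero, kms_succ]
  rw [← Finset.sum_add_distrib, Finset.mul_sum]
  exact Finset.sum_congr rfl fun k _ => by ring

theorem star_shiftVec_dotProduct_kms {n : ℕ} (a : ℂ) {x : Fin (n + 1) → ℂ}
    (hx : x (Fin.last n) = 0) :
    star (shiftVec x) ⬝ᵥ (KMS (n + 1) a *ᵥ shiftVec x) = star x ⬝ᵥ (KMS (n + 1) a *ᵥ x) := by
  simp only [mulVec, dotProduct]
  refine (Fin.sum_univ_succ _).trans (Eq.trans ?_ (Fin.sum_univ_castSucc _).symm)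
  have h0 : star (shiftVec x) 0 = 0 := by simp [shiftVec]
  have hl : star x (Fin.last n) = 0 := by simp [hx]
  rw [h0, hl, zero_mul, zero_mul, zero_add, add_zero]
  refine Finset.sum_congr rfl fun j _ => ?_
  rw [Fin.sum_univ_succ, Fin.sum_univ_castSucc fun k => KMS (n + 1) a j.castSucc k * x k]
  simp [shiftVec, hx, kms_succ_succ]

theorem eq_zero_of_shiftVec_eq_smul {n : ℕ} {x : Fin (n + 1) → ℂ} {c : ℂ} (hc : c ≠ 0)
    (h : shiftVec x = c • x) : x = 0 := by
  ext j
  induction j using Fin.induction with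
  | zero =>
    have := congrFun h 0
    simpa [shiftVec, hc] using this.symm
  | succ j ih =>
    have := congrFun h j.succ
    simp only [shiftVec, Fin.cons_succ, Pi.smul_apply, smul_eq_mul, ih, Pi.zero_apply] at this
    simpa [hc] using this.symm

theorem kms_pow_mulVec_apply {n : ℕ} (a : ℂ) (x : Fin (n + 1) → ℂ) (k : ℕ) :
    (∀ j : Fin (n + 1), n < j + k → (KMS (n + 1) a ^ k *ᵥ x) j = 0) ∧
    ∀ j : Fin (n + 1), (j : ℕ) + k = n → (KMS (n + 1) a ^ k *ᵥ x) j = a ^ k * x (Fin.last n) := by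
  induction k with
  | zero =>
    refine ⟨fun j hj => absurd j.is_lt (by omega), fun j hj => ?_⟩
    obtain rfl : j = Fin.last n := Fin.ext (by simpa using hj)
    simp
  | succ k ih =>
    simp only [pow_succ', ← mulVec_mulVec]
    generalize KMS (n + 1) a ^ k *ᵥ x = y at ih ⊢
    simp only [mulVec, dotProduct]
    refine ⟨fun j hj => Finset.sum_eq_zero fun l _ => ?_, fun j hj => ?_⟩
    · by_cases h : (j : ℕ) < l
      · rw [ih.1 l (by omega), mul_zero]
      · rw [show KMS (n + 1) a j l = 0 from if_neg h, zero_mul]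
    · have hl : (j : ℕ) + 1 < n + 1 := by omega
      refine (Finset.sum_eq_single (⟨j + 1, hl⟩ : Fin (n + 1)) (fun l _ hne => ?_)
        (by simp)).trans ?_
      · by_cases h : (j : ℕ) < l
        · have : (l : ℕ) ≠ j + 1 := fun h' => hne (Fin.ext h')
          rw [ih.1 l (by omega), mul_zero]
        · rw [show KMS (n + 1) a j l = 0 from if_neg h, zero_mul]
      · rw [ih.2 _ (by simp only []; omega)]
        simp only [KMS, of_apply, Nat.lt_succ_self, if_true, Nat.add_sub_cancel_left, pow_one]
        ring

theorem kms_span_eq_top {n : ℕ} {a : ℂ} (ha : a ≠ 0) {x : Fin (n + 1) → ℂ}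
    (hx : x (Fin.last n) ≠ 0) :
    Submodule.span ℂ (Set.range fun k : Fin (n + 1) => (KMS (n + 1) a) ^ (k : ℕ) *ᵥ x) = ⊤ := by
  let M : Matrix (Fin (n + 1)) (Fin (n + 1)) ℂ :=
    of fun j => KMS (n + 1) a ^ (j.rev : ℕ) *ᵥ x
  have hrev : ∀ j : Fin (n + 1), (j : ℕ) + (j.rev : ℕ) = n := fun j => by
    rw [Fin.val_rev]; omega
  have hdet : M.det ≠ 0 := by
    rw [det_of_isLowerTriangular (M := M)]
    · refine Finset.prod_ne_zero_iff.2 fun j _ => ?_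
      have : M j j = a ^ (j.rev : ℕ) * x (Fin.last n) := (kms_pow_mulVec_apply a x _).2 j (hrev j)
      rw [this]
      exact mul_ne_zero (pow_ne_zero _ ha) hx
    · intro i j hij
      have hij' : (i : ℕ) < j := by simpa using hij
      exact (kms_pow_mulVec_apply a x _).1 j (by have := hrev i; omega)
  have hspan := (linearIndependent_rows_of_det_ne_zero hdet).span_eq_top_of_card_eq_finrank'
    (by simp)
  rw [← hspan, ← Fin.rev_surjective.range_comp]
  rfl

/-- If `x` is a unit vector such that `λ = ⟨J_n(a)x, x⟩` lies on the boundary of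
`W(J_n(a))` but on no nondegenerate line segment contained in that boundary, then `x` is a
cyclic vector for `J_n(a)`. -/
theorem stmt_13 (n : ℕ) (a : ℂ) (ha : a ≠ 0) (x : Fin n → ℂ) (hx : star x ⬝ᵥ x = 1)
    (hbd : star x ⬝ᵥ (KMS n a *ᵥ x) ∈ frontier (numRange (KMS n a)))
    (hseg : ¬ ∃ z w : ℂ, z ≠ w ∧ star x ⬝ᵥ (KMS n a *ᵥ x) ∈ segment ℝ z w ∧
        segment ℝ z w ⊆ frontier (numRange (KMS n a))) :
    Submodule.span ℂ (Set.range fun k : Fin n => (KMS n a) ^ (k : ℕ) *ᵥ x) = ⊤ := by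
  cases n with
  | zero => simp [dotProduct] at hx
  | succ n =>
  refine kms_span_eq_top ha fun hlast => ?_
  obtain ⟨f, hf⟩ := (convex_numRange (KMS (n + 1) a)).exists_forall_le_and_eq_of_mem_frontier
    ⟨x, hx, rfl⟩ hbd hseg
  set p := star x ⬝ᵥ (KMS (n + 1) a *ᵥ x) with hp
  have hpx : star x ⬝ᵥ (KMS (n + 1) a *ᵥ x) = p * (star x ⬝ᵥ x) := by rw [hx, mul_one]
  have hyy : star (shiftVec x) ⬝ᵥ shiftVec x = 1 := by rw [star_shiftVec_dotProduct hlast, hx]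
  have hqy : star (shiftVec x) ⬝ᵥ (KMS (n + 1) a *ᵥ shiftVec x) = p :=
    star_shiftVec_dotProduct_kms a hlast
  have hpy : star (shiftVec x) ⬝ᵥ (KMS (n + 1) a *ᵥ shiftVec x) =
      p * (star (shiftVec x) ⬝ᵥ shiftVec x) := by rw [hyy, mul_one, hqy]
  have hxy := dotProduct_mulVec_eq_of_exposed hf hpy hpx
  have hyx := dotProduct_mulVec_eq_of_exposed hf hpx hpy
  rw [kms_mulVec_shiftVec a hlast, dotProduct_smul, dotProduct_add, smul_eq_mul] at hxy hqy
  rw [hx, ← hp] at hxy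
  rw [hyx] at hqy
  set y := shiftVec x with hy
  set c := star x ⬝ᵥ y with hc
  set d := star y ⬝ᵥ x with hd
  have hdc : d = star c := by rw [hd, hc, star_dotProduct]
  have hprod : p * (1 - d * c) = 0 := by linear_combination -hqy + d * hxy
  have hp0 : p ≠ 0 := by
    intro h
    rw [h] at hxy
    exact ha (by linear_combination hxy)
  have hcd : 1 - d * c = 0 := (mul_eq_zero.1 hprod).resolve_left hp0
  have hc0 : c ≠ 0 := by rintro h; simp [h] at hcd
  have hsub : y - c • x = 0 := by
    open scoped ComplexOrder in rw [← dotProduct_star_self_eq_zero]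
    simp only [star_sub, star_smul, sub_dotProduct, dotProduct_sub, smul_dotProduct,
      dotProduct_smul, smul_eq_mul, hyy, hx, ← hc, ← hd, ← hdc]
    linear_combination hcd
  have hx0 := eq_zero_of_shiftVec_eq_smul hc0 (sub_eq_zero.1 hsub)
  simp [hx0] at hx
end
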